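/- arXiv:1703.01334 — 3 statements merged into one kernel-verified Lean document; each statement's English description precedes it below -/
import Mathlib

section
/- Assume 𝕋 is the κ-regular tree with κ ≥ 3 (every vertex has degree exactly κ). Then the flow functions are pairwise orthogonal with explicit norms: for all signs ε, ε' ∈ {+1, −1}, all u, u' ∈ V, all j ∈ {1, …, m(u)−1} and j' ∈ {1, …, m(u')−1}, the inner product ⟨φ_{u,j}^(ε), φ_{u',j'}^(ε')⟩ equals 2(κ−1)/(m(u)(κ−2)) if ε = ε', u = u' and j = j', and equals 0 otherwise. -/
/- Setting: 𝕋 = (V,A) an infinite, locally finite tree. Vertices `V`, arcs = darts of a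
simple graph `G`; `e.fst` = origin, `e.snd` = terminus, `e.symm` = reversed arc.
ℓ²(A) and ℓ²(V) are the `lp _ 2` spaces. The boundary operators, the shift and the
Grover walk are characterized by their pointwise formulas. -/

noncomputable section
open scoped ComplexConjugate ComplexInnerProductSpace Classical
open Complex Filter Topology ContinuousLinearMap

namespace GroverStmt

/-- ℓ²(V) -/
abbrev lV (V : Type) : Type := lp (fun _ : V => ℂ) 2

variable {V : Type} (G : SimpleGraph V)

/-- ℓ²(A) where A is the set of symmetric arcs (darts) of `G`. -/
abbrev lA : Type := lp (fun _ : G.Dart => ℂ) 2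

section deg
variable [∀ v : V, Fintype (G.neighborSet v)]

/-- `(d_T ψ)(u) = Σ_{e : t(e)=u} ψ(e)/√(deg u)` -/
def IsBoundaryT (dT : lA G →L[ℂ] lV V) : Prop :=
  ∀ (ψ : lA G) (u : V),
    dT ψ u = ∑' e : {e : G.Dart // e.snd = u}, ψ e.1 / (Real.sqrt (G.degree u) : ℂ)

/-- `(d_O ψ)(u) = Σ_{e : o(e)=u} ψ(e)/√(deg u)` -/
def IsBoundaryO (dO : lA G →L[ℂ] lV V) : Prop :=
  ∀ (ψ : lA G) (u : V),
    dO ψ u = ∑' e : {e : G.Dart // e.fst = u}, ψ e.1 / (Real.sqrt (G.degree u) : ℂ)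

end deg

/-- `(Sψ)(e) = ψ(ē)` -/
def IsShift (S : lA G →L[ℂ] lA G) : Prop :=
  ∀ (ψ : lA G) (e : G.Dart), S ψ e = ψ e.symm

/-- the Grover walk `U = S (2 d_T* d_T − 1)` -/
def grover (S : lA G →L[ℂ] lA G) (dT : lA G →L[ℂ] lV V) : lA G →L[ℂ] lA G :=
  S ∘L ((2 : ℂ) • ((adjoint dT) ∘L dT) - 1)

variable (o : V)

/-- `v` is a descendant of `u` (w.r.t. the root `o`). -/
def desc (u v : V) : Prop := G.dist o v = G.dist o u + G.dist u v

/-- `e` is an arc pointing away from `u` inside the subtree of descendants of `u`. -/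
def awayIn (u : V) (e : G.Dart) : Prop :=
  desc G o u e.fst ∧ desc G o u e.snd ∧ G.dist u e.fst < G.dist u e.snd

section flows
variable [∀ v : V, Fintype (G.neighborSet v)]

/-- `m(u)`: the number of children of `u`. -/
def m (u : V) : ℕ := if u = o then G.degree u else G.degree u - 1

/-- `En u : Fin (m u) → Dart` is an enumeration `e_0^(u), …, e_{m(u)-1}^(u)` of the arcs
from `u` to its children. -/
def IsChildEnum (En : ∀ u : V, Fin (m G o u) → G.Dart) : Prop :=
  ∀ u : V,
    Function.Injective (En u) ∧
    (∀ k, (En u k).fst = u ∧ G.dist o (En u k).snd = G.dist o u + 1) ∧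
    (∀ e : G.Dart, e.fst = u → G.dist o e.snd = G.dist o u + 1 → ∃ k, En u k = e)

/-- the defining properties of the flow function `φ_{u,j}^(ε) : A → ℂ`. -/
def IsFlow (En : ∀ u : V, Fin (m G o u) → G.Dart)
    (u : V) (j : ℕ) (ε : ℂ) (φ : G.Dart → ℂ) : Prop :=
  (∀ k : Fin (m G o u),
      φ (En u k) =
        Complex.exp (2 * Real.pi * Complex.I * j / (m G o u)) ^ (k : ℕ) / (m G o u)) ∧
  (∀ e : G.Dart, awayIn G o u e → e.fst ≠ u →
     ∀ f : G.Dart, awayIn G o u f → f.snd = e.fst →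
       φ e = ε * φ f / (m G o e.fst)) ∧
  (∀ e : G.Dart, awayIn G o u e → φ e.symm = -ε * φ e) ∧
  (∀ e : G.Dart, ¬(desc G o u e.fst ∧ desc G o u e.snd) → φ e = 0)

end flows


section tree
variable {G o}

/-- The dart `e` points away from the root. -/
def outward (G : SimpleGraph V) (o : V) (e : G.Dart) : Prop :=
  G.dist o e.snd = G.dist o e.fst + 1

lemma outward_or_outward_symm (hG : G.IsTree) (e : G.Dart) :
    outward G o e ∨ outward G o e.symm :=
  (hG.dist_eq_dist_add_one_of_adj o e.adj).symm

lemma outward.not_symm {e : G.Dart} (h : outward G o e) : ¬ outward G o e.symm := by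
  intro h'
  have h'' : G.dist o e.fst = G.dist o e.snd + 1 := h'
  unfold outward at h
  omega

lemma exists_adj_dist_eq (hG : G.Connected) {u w : V} {k : ℕ} (h : G.dist u w = k + 1) :
    ∃ b, G.Adj b w ∧ G.dist u b = k := by
  obtain ⟨p, hp⟩ := hG.exists_walk_length_eq_dist u w
  have hnil : ¬ p.Nil := by
    intro hn
    have := SimpleGraph.Walk.length_eq_zero_iff.2 hn
    omega
  have hadj := p.adj_penultimate hnil
  refine ⟨p.penultimate, hadj, ?_⟩
  have h1 := SimpleGraph.dist_le p.dropLast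
  have h2 : p.dropLast.length = p.length - 1 := by simp
  have h3 := hG.dist_triangle (u := u) (v := p.penultimate) (w := w)
  have h4 := SimpleGraph.dist_eq_one_iff_adj.2 hadj
  omega

lemma parent_unique (hG : G.IsTree) {a b w : V} (ha : G.Adj a w) (hb : G.Adj b w)
    (hda : G.dist o w = G.dist o a + 1) (hdb : G.dist o w = G.dist o b + 1) : a = b := by
  obtain ⟨p, hp⟩ := hG.connected.exists_walk_length_eq_dist o a
  obtain ⟨q, hq⟩ := hG.connected.exists_walk_length_eq_dist o b
  have h1 : (p.concat ha).IsPath := SimpleGraph.Walk.isPath_of_length_eq_dist _ (by simp; omega)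
  have h2 : (q.concat hb).IsPath := SimpleGraph.Walk.isPath_of_length_eq_dist _ (by simp; omega)
  have h3 := (hG.isAcyclic.subsingleton_path o w).elim ⟨_, h1⟩ ⟨_, h2⟩
  have h4 : p.concat ha = q.concat hb := congrArg Subtype.val h3
  have h5 := congrArg SimpleGraph.Walk.penultimate h4
  simpa using h5

lemma outward.eq_of_snd_eq (hG : G.IsTree) {e f : G.Dart} (he : outward G o e)
    (hf : outward G o f) (h : e.snd = f.snd) : e = f := by
  have h1 : e.fst = f.fst := parent_unique hG e.adj (h ▸ f.adj) he (by rw [h]; exact hf)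
  exact SimpleGraph.Dart.ext _ _ (Prod.ext h1 h)

lemma exists_outward_snd_eq (hG : G.IsTree) {w : V} (hw : w ≠ o) :
    ∃ f : G.Dart, outward G o f ∧ f.snd = w := by
  obtain ⟨k, hk⟩ := Nat.exists_eq_succ_of_ne_zero
    (hG.connected.pos_dist_of_ne hw.symm).ne'
  obtain ⟨b, hb, hd⟩ := exists_adj_dist_eq hG.connected hk
  refine ⟨⟨(b, w), hb⟩, ?_, rfl⟩
  change G.dist o w = G.dist o b + 1
  omega

lemma desc.eq_of_dist_le (hG : G.IsTree) {u v : V} (h : desc G o u v)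
    (hle : G.dist o v ≤ G.dist o u) : v = u := by
  unfold desc at h
  exact (hG.connected.dist_eq_zero_iff.1 (by omega : G.dist u v = 0)).symm

lemma desc.snd (hG : G.IsTree) {u : V} {e : G.Dart} (h : desc G o u e.fst)
    (he : outward G o e) : desc G o u e.snd := by
  unfold desc outward at *
  have h1 := hG.connected.dist_triangle (u := u) (v := e.fst) (w := e.snd)
  have h2 := SimpleGraph.dist_eq_one_iff_adj.2 e.adj
  have h3 := hG.connected.dist_triangle (u := o) (v := u) (w := e.snd)
  omega

lemma desc.fst (hG : G.IsTree) {u : V} {f : G.Dart} (h : desc G o u f.snd)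
    (hf : outward G o f) (hne : f.snd ≠ u) : desc G o u f.fst := by
  obtain ⟨k, hk⟩ := Nat.exists_eq_succ_of_ne_zero
    (hG.connected.pos_dist_of_ne hne.symm).ne'
  obtain ⟨b, hb, hd⟩ := exists_adj_dist_eq hG.connected hk
  have h1 := hG.connected.dist_triangle (u := o) (v := u) (w := b)
  have h2 := hG.dist_eq_dist_add_one_of_adj o hb
  unfold desc at h
  have h3 : b = f.fst := parent_unique hG hb f.adj (by omega) hf
  unfold desc
  rw [← h3]
  omega

lemma outward.awayIn (hG : G.IsTree) {u : V} {e : G.Dart} (he : outward G o e)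
    (h : desc G o u e.fst) : awayIn G o u e := by
  have h' := h.snd hG he
  refine ⟨h, h', ?_⟩
  unfold desc outward at *
  omega

end tree

section flowLemmas
variable {G o}
variable [∀ v : V, Fintype (G.neighborSet v)] {En : ∀ u : V, Fin (m G o u) → G.Dart}

namespace IsFlow
variable {u : V} {j : ℕ} {ε : ℂ} {φ : G.Dart → ℂ}

lemma eq_zero_of_not_desc (h : IsFlow G o En u j ε φ) {e : G.Dart}
    (he : ¬ desc G o u e.fst) : φ e = 0 :=
  h.2.2.2 e fun h' => he h'.1

lemma apply_symm (hG : G.IsTree) (hε : ε = 1 ∨ ε = -1) (h : IsFlow G o En u j ε φ)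
    (e : G.Dart) : φ e.symm = -ε * φ e := by
  by_cases hd : desc G o u e.fst ∧ desc G o u e.snd
  · rcases outward_or_outward_symm (o := o) hG e with he | he
    · exact h.2.2.1 e (he.awayIn hG hd.1)
    · have := h.2.2.1 e.symm (he.awayIn hG hd.2)
      rw [SimpleGraph.Dart.symm_symm] at this
      rw [this]
      rcases hε with rfl | rfl <;> ring
  · rw [h.2.2.2 e hd, h.2.2.2 e.symm fun h' => hd ⟨h'.2, h'.1⟩, mul_zero]

lemma apply_child (hG : G.IsTree) (h : IsFlow G o En u j ε φ) {e f : G.Dart}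
    (he : outward G o e) (hf : outward G o f) (hfe : f.snd = e.fst) (hne : e.fst ≠ u) :
    φ e = ε * φ f / (m G o e.fst) := by
  by_cases hd : desc G o u e.fst
  · exact h.2.1 e (he.awayIn hG hd) hne f
      (hf.awayIn hG (desc.fst hG (hfe ▸ hd) hf (hfe ▸ hne))) hfe
  · rw [h.eq_zero_of_not_desc hd, h.2.2.2 f fun h' => hd (hfe ▸ h'.2)]
    simp

end IsFlow

lemma sum_conj_exp_pow_mul_exp_pow {M j j' : ℕ} (hj : j < M) (hj' : j' < M) :
    ∑ k : Fin M, conj (exp (2 * Real.pi * I * j / M) ^ (k : ℕ)) *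
      exp (2 * Real.pi * I * j' / M) ^ (k : ℕ) = if j = j' then (M : ℂ) else 0 := by
  have hM : M ≠ 0 := by omega
  have hξ := Complex.isPrimitiveRoot_exp M hM
  set ξ := exp (2 * Real.pi * I / M) with hξdef
  have hexp (i : ℕ) : exp (2 * Real.pi * I * i / M) = ξ ^ i := by
    rw [hξdef, ← Complex.exp_nat_mul]; congr 1; ring
  have hξ0 : ξ ≠ 0 := hξ.ne_zero hM
  have hconj : conj ξ = ξ⁻¹ := (Complex.inv_eq_conj (hξ.norm'_eq_one hM)).symm
  have hterm (k : Fin M) : conj (exp (2 * Real.pi * I * j / M) ^ (k : ℕ)) *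
      exp (2 * Real.pi * I * j' / M) ^ (k : ℕ) = ((ξ ^ j)⁻¹ * ξ ^ j') ^ (k : ℕ) := by
    rw [hexp, hexp, mul_pow, map_pow, map_pow, hconj, inv_pow]
  simp_rw [hterm]
  rw [Fin.sum_univ_eq_sum_range (fun k => ((ξ ^ j)⁻¹ * ξ ^ j') ^ k) M]
  split_ifs with h
  · subst h
    simp [inv_mul_cancel₀ (pow_ne_zero j hξ0)]
  · have hne : (ξ ^ j)⁻¹ * ξ ^ j' ≠ 1 := by
      intro h1
      rw [inv_mul_eq_one₀ (pow_ne_zero j hξ0)] at h1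
      exact h (hξ.pow_inj hj hj' h1)
    rw [geom_sum_eq hne, mul_pow, inv_pow, ← pow_mul, ← pow_mul, mul_comm j, mul_comm j',
      pow_mul, pow_mul, hξ.pow_eq_one]
    simp

lemma sum_exp_pow {M j : ℕ} (hj0 : 1 ≤ j) (hj : j < M) :
    ∑ k : Fin M, exp (2 * Real.pi * I * j / M) ^ (k : ℕ) = 0 := by
  have := sum_conj_exp_pow_mul_exp_pow (M := M) (j := 0) (j' := j) (by omega) hj
  rw [if_neg (by omega)] at this
  simpa using this

/-- The darts pointing away from the root whose origin is at distance `n` from it. -/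
abbrev Lev (G : SimpleGraph V) (o : V) (n : ℕ) : Type :=
  {e : G.Dart // G.dist o e.fst = n ∧ outward G o e}

lemma IsChildEnum.outward (hEn : IsChildEnum G o En) (u : V) (k : Fin (m G o u)) :
    outward G o (En u k) := by
  have h := (hEn u).2.1 k
  unfold GroverStmt.outward
  rw [h.2, h.1]

/-- Passing from a dart to the darts that continue it. -/
def child (hEn : IsChildEnum G o En) (n : ℕ) :
    (Σ e : Lev G o n, Fin (m G o e.1.snd)) → Lev G o (n + 1) :=
  fun x => ⟨En x.1.1.snd x.2, by
    rw [((hEn x.1.1.snd).2.1 x.2).1]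
    have := x.1.2
    unfold GroverStmt.outward at this
    omega, hEn.outward _ _⟩

lemma child_bijective (hG : G.IsTree) (hEn : IsChildEnum G o En) (n : ℕ) :
    Function.Bijective (child hEn n) := by
  constructor
  · rintro ⟨e, k⟩ ⟨e', k'⟩ h
    have h1 : En e.1.snd k = En e'.1.snd k' := congrArg Subtype.val h
    have h2 : e.1.snd = e'.1.snd := by
      rw [← ((hEn e.1.snd).2.1 k).1, ← ((hEn e'.1.snd).2.1 k').1, h1]
    obtain rfl : e = e' := Subtype.ext (e.2.2.eq_of_snd_eq hG e'.2.2 h2)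
    rw [(hEn e.1.snd).1 h1]
  · rintro ⟨d, hd, hout⟩
    have hne : d.fst ≠ o := by
      rintro rfl
      simp at hd
    obtain ⟨f, hf, hfd⟩ := exists_outward_snd_eq hG hne
    have hf' := hf
    have hout' := hout
    unfold GroverStmt.outward at hf' hout'
    obtain ⟨k, hk⟩ := (hEn f.snd).2.2 d hfd.symm (by rw [hfd]; exact hout)
    exact ⟨⟨⟨f, by rw [hfd] at hf'; omega, hf⟩, k⟩, Subtype.ext hk⟩

lemma finite_lev (hG : G.IsTree) (hEn : IsChildEnum G o En) (n : ℕ) : Finite (Lev G o n) := by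
  induction n with
  | zero =>
    refine Finite.of_surjective
      (fun k => (⟨En o k, by rw [((hEn o).2.1 k).1]; simp, hEn.outward o k⟩ : Lev G o 0)) ?_
    rintro ⟨d, hd, hout⟩
    have hdo : d.fst = o := (hG.connected.dist_eq_zero_iff.1 hd).symm
    obtain ⟨k, hk⟩ := (hEn o).2.2 d hdo (by have := hout; unfold GroverStmt.outward at this; rwa [hdo] at this)
    exact ⟨k, Subtype.ext hk⟩
  | succ n ih => exact Finite.of_surjective _ (child_bijective hG hEn n).2

/-- The sum of `F` over the `n`-th level. -/
def levSum {R : Type*} [AddCommMonoid R] (F : G.Dart → R) (o : V) (n : ℕ) : R :=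
  ∑ᶠ e : Lev G o n, F e.1

lemma levSum_succ {R : Type*} [Field R] [CharZero R] (hG : G.IsTree)
    (hEn : IsChildEnum G o En) {κ : ℕ} (hκ : 3 ≤ κ) (hreg : ∀ v : V, G.degree v = κ)
    {F : G.Dart → R} {n : ℕ}
    (hF : ∀ e f : G.Dart, outward G o e → outward G o f → f.snd = e.fst →
      G.dist o e.fst = n + 1 → F e = F f / (m G o e.fst : R) ^ 2) :
    levSum F o (n + 1) = ((κ : R) - 1)⁻¹ * levSum F o n := by
  have := finite_lev hG hEn
  have (n : ℕ) : Fintype (Lev G o n) := Fintype.ofFinite _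
  unfold levSum
  rw [finsum_eq_sum_of_fintype, finsum_eq_sum_of_fintype,
    ← (Equiv.ofBijective _ (child_bijective hG hEn n)).sum_comp, Fintype.sum_sigma,
    Finset.mul_sum]
  refine Finset.sum_congr rfl fun e _ => ?_
  have hout := e.2
  unfold GroverStmt.outward at hout
  have hm : (m G o e.1.snd : R) = (κ : R) - 1 := by
    have : e.1.snd ≠ o := by
      intro h
      rw [h, SimpleGraph.dist_self] at hout
      omega
    rw [m, if_neg this, hreg, Nat.cast_sub (by omega), Nat.cast_one]
  have hκ1 : (κ : R) - 1 ≠ 0 := by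
    rw [sub_ne_zero]
    exact_mod_cast (by omega : κ ≠ 1)
  have hterm (k : Fin (m G o e.1.snd)) :
      F (En e.1.snd k) = F e.1 / ((κ : R) - 1) ^ 2 := by
    have hfst := ((hEn e.1.snd).2.1 k).1
    rw [hF _ e.1 (hEn.outward _ k) e.2.2 hfst.symm (by rw [hfst]; omega), hfst, hm]
  change ∑ k, F (En e.1.snd k) = _
  simp_rw [hterm]
  rw [Finset.sum_const, Finset.card_univ, Fintype.card_fin, nsmul_eq_mul, hm]
  field_simp

lemma levSum_add {R : Type*} [Field R] [CharZero R] (hG : G.IsTree)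
    (hEn : IsChildEnum G o En) {κ : ℕ} (hκ : 3 ≤ κ) (hreg : ∀ v : V, G.degree v = κ)
    {F : G.Dart → R} {N : ℕ}
    (hF : ∀ e f : G.Dart, outward G o e → outward G o f → f.snd = e.fst →
      N < G.dist o e.fst → F e = F f / (m G o e.fst : R) ^ 2) (i : ℕ) :
    levSum F o (i + N) = levSum F o N * ((κ : R) - 1)⁻¹ ^ i := by
  induction i with
  | zero => simp
  | succ i ih =>
    rw [show i + 1 + N = i + N + 1 by ring, levSum_succ hG hEn hκ hreg, ih]
    · ring
    · intro e f he hf hfe hd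
      exact hF e f he hf hfe (by omega)

/-- Summation of a function which decays geometrically from level `N` on. -/
lemma hasSum_of_levSum (hG : G.IsTree) (hEn : IsChildEnum G o En) {κ : ℕ} (hκ : 3 ≤ κ)
    (hreg : ∀ v : V, G.degree v = κ) {F : G.Dart → ℂ} {N : ℕ}
    (hsymm : ∀ e, F e.symm = F e)
    (hzero : ∀ e : G.Dart, G.dist o e.fst < N → outward G o e → F e = 0)
    (hF : ∀ e f : G.Dart, outward G o e → outward G o f → f.snd = e.fst →
      N < G.dist o e.fst → F e = F f / (m G o e.fst : ℂ) ^ 2) :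
    HasSum F (2 * (levSum F o N * (((κ : ℂ) - 1) / ((κ : ℂ) - 2)))) := by
  have hfin := finite_lev hG hEn
  have (n : ℕ) : Fintype (Lev G o n) := Fintype.ofFinite _
  have hκR : (3 : ℝ) ≤ κ := by exact_mod_cast hκ
  have hκC : (κ : ℂ) - 2 ≠ 0 := by
    rw [sub_ne_zero]; exact_mod_cast (by omega : κ ≠ 2)
  have hκC1 : (κ : ℂ) - 1 ≠ 0 := by
    rw [sub_ne_zero]; exact_mod_cast (by omega : κ ≠ 1)
  let g : (Σ n, Lev G o n) → ℂ := fun x => F x.2.1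
  have hlev {n : ℕ} (hn : n < N) : levSum F o n = 0 :=
    finsum_eq_zero_of_forall_eq_zero fun e => hzero e.1 (by rw [e.2.1]; exact hn) e.2.2
  have hsumm : Summable g := by
    rw [← summable_norm_iff, summable_sigma_of_nonneg fun _ => norm_nonneg _]
    refine ⟨fun n => (hasSum_fintype _).summable, ?_⟩
    have heq : (fun n => ∑' e : Lev G o n, ‖g ⟨n, e⟩‖) = levSum (fun e => ‖F e‖) o := by
      funext n
      rw [tsum_fintype, levSum, finsum_eq_sum_of_fintype]
    rw [heq, ← summable_nat_add_iff N]
    have := levSum_add (F := fun e => ‖F e‖) (N := N) hG hEn hκ hreg fun e f he hf hfe hd => by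
      simp [hF e f he hf hfe hd]
    simp_rw [this]
    refine (summable_geometric_of_lt_one ?_ ?_).mul_left _
    · exact inv_nonneg.2 (by linarith)
    · exact inv_lt_one_of_one_lt₀ (by linarith)
  have hg : HasSum g (levSum F o N * (((κ : ℂ) - 1) / ((κ : ℂ) - 2))) := by
    refine HasSum.of_sigma (g := levSum F o) (fun n => ?_) ?_ hsumm.hasSum.cauchySeq
    · rw [levSum, finsum_eq_sum_of_fintype]
      exact hasSum_fintype _
    · rw [← hasSum_nat_add_iff' N,
        Finset.sum_eq_zero fun n hn => hlev (Finset.mem_range.1 hn), sub_zero]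
      simp_rw [levSum_add hG hEn hκ hreg hF]
      refine HasSum.mul_left _ ?_
      have hlt : ‖((κ : ℂ) - 1)⁻¹‖ < 1 := by
        rw [norm_inv, show (κ : ℂ) - 1 = ((κ - 1 : ℝ) : ℂ) by push_cast; ring,
          Complex.norm_real, Real.norm_of_nonneg (by linarith)]
        exact inv_lt_one_of_one_lt₀ (by linarith)
      have hq : (1 - ((κ : ℂ) - 1)⁻¹)⁻¹ = ((κ : ℂ) - 1) / ((κ : ℂ) - 2) := by
        rw [← inv_div]
        congr 1
        field_simp
        ring
      rw [← hq]
      exact hasSum_geometric_of_norm_lt_one hlt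
  have hinj : Function.Injective (fun x : Σ n, Lev G o n => x.2.1) := by
    rintro ⟨n, e, he⟩ ⟨n', e', he'⟩ (rfl : e = e')
    obtain rfl : n = n' := he.1.symm.trans he'.1
    rfl
  have hinj' : Function.Injective (fun x : Σ n, Lev G o n => x.2.1.symm) :=
    SimpleGraph.Dart.symm_involutive.injective.comp hinj
  rw [two_mul]
  refine HasSum.add_isCompl ?_ (hinj.hasSum_range_iff.2 hg)
    (hinj'.hasSum_range_iff.2 ?_)
  · rw [isCompl_iff, Set.disjoint_left, codisjoint_iff_le_sup]
    constructor
    · rintro _ ⟨⟨n, e⟩, rfl⟩ ⟨⟨n', e'⟩, h⟩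
      have h' : e'.1.symm = e.1 := h
      exact e'.2.2.not_symm (h' ▸ e.2.2)
    · intro e _
      rcases outward_or_outward_symm (o := o) hG e with he | he
      · exact Or.inl ⟨⟨_, e, rfl, he⟩, rfl⟩
      · exact Or.inr ⟨⟨_, e.symm, rfl, he⟩, e.symm_symm⟩
  · have : F ∘ (fun x : Σ n, Lev G o n => x.2.1.symm) = g := funext fun x => hsymm _
    exact this ▸ hg

end flowLemmas

section pairs
variable {G o}
variable [∀ v : V, Fintype (G.neighborSet v)] {En : ∀ u : V, Fin (m G o u) → G.Dart}
  {u u' : V} {j j' : ℕ} {ε ε' : ℂ} {φ φ' : G.Dart → ℂ}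

lemma levSum_eq_sum_child (hG : G.IsTree) (hEn : IsChildEnum G o En) {F : G.Dart → ℂ}
    (hF : ∀ e : G.Dart, outward G o e → G.dist o e.fst = G.dist o u → e.fst ≠ u → F e = 0) :
    levSum F o (G.dist o u) = ∑ k, F (En u k) := by
  have := finite_lev hG hEn
  have (n : ℕ) : Fintype (Lev G o n) := Fintype.ofFinite _
  rw [levSum, finsum_eq_sum_of_fintype]
  symm
  refine Fintype.sum_of_injective
    (fun k => (⟨En u k, by rw [((hEn u).2.1 k).1], hEn.outward u k⟩ : Lev G o (G.dist o u)))
    ?_ _ _ ?_ fun k => rfl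
  · intro k k' h
    exact (hEn u).1 (congrArg Subtype.val h)
  · rintro ⟨e, he, hout⟩ hnot
    refine hF e hout he fun h => hnot ?_
    obtain ⟨k, hk⟩ := (hEn u).2.2 e h (by rw [← he]; exact hout)
    exact ⟨k, Subtype.ext hk⟩

lemma conj_sign (hε : ε = 1 ∨ ε = -1) : conj ε = ε := by
  rcases hε with rfl | rfl <;> simp

lemma sign_mul_self (hε : ε = 1 ∨ ε = -1) : ε * ε = 1 := by
  rcases hε with rfl | rfl <;> simp

lemma tsum_flow_same_sign (hG : G.IsTree) {κ : ℕ} (hκ : 3 ≤ κ)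
    (hreg : ∀ v : V, G.degree v = κ) (hEn : IsChildEnum G o En)
    (h : IsFlow G o En u j ε φ) (h' : IsFlow G o En u' j' ε φ') (hε : ε = 1 ∨ ε = -1)
    (hj : j < m G o u) (hj0' : 1 ≤ j') (hj' : j' < m G o u')
    (hle : G.dist o u ≤ G.dist o u') :
    ∑' e : G.Dart, conj (φ e) * φ' e = if u = u' ∧ j = j' then
      (2 * ((κ : ℂ) - 1)) / ((m G o u : ℂ) * ((κ : ℂ) - 2)) else 0 := by
  have hzero (e : G.Dart) (hd : G.dist o e.fst < G.dist o u') : φ' e = 0 := by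
    refine h'.eq_zero_of_not_desc fun hdesc => ?_
    unfold desc at hdesc
    omega
  have hlev : levSum (fun e => conj (φ e) * φ' e) o (G.dist o u') =
      if u = u' ∧ j = j' then ((m G o u : ℂ))⁻¹ else 0 := by
    rw [levSum_eq_sum_child hG hEn fun e _ hd hne => by
      rw [h'.eq_zero_of_not_desc fun hdesc => hne (hdesc.eq_of_dist_le hG hd.le), mul_zero]]
    by_cases hu : u = u'
    · subst hu
      have hm : (m G o u : ℂ) ≠ 0 := by exact_mod_cast (by omega : m G o u ≠ 0)
      simp_rw [h.1, h'.1, map_div₀, div_mul_div_comm, Complex.conj_natCast]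
      rw [← Finset.sum_div, sum_conj_exp_pow_mul_exp_pow hj hj']
      by_cases hjj : j = j'
      · simp [hjj]
      · simp [hjj]
    · rw [if_neg fun hh => hu hh.1]
      obtain ⟨c, hc⟩ : ∃ c, ∀ k, φ (En u' k) = c := by
        by_cases ho : u' = o
        · refine ⟨0, fun k => h.eq_zero_of_not_desc fun hdesc => ?_⟩
          rw [((hEn u').2.1 k).1] at hdesc
          refine hu (hdesc.eq_of_dist_le hG ?_).symm
          simp [ho]
        · obtain ⟨f, hf, hfu⟩ := exists_outward_snd_eq hG ho
          refine ⟨ε * φ f / m G o u', fun k => ?_⟩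
          have hfst := ((hEn u').2.1 k).1
          rw [h.apply_child hG (hEn.outward u' k) hf (hfu.trans hfst.symm)
            (by rw [hfst]; exact Ne.symm hu), hfst]
      simp_rw [hc, h'.1]
      rw [← Finset.mul_sum, ← Finset.sum_div, sum_exp_pow hj0' hj']
      simp
  have hsum := hasSum_of_levSum (F := fun e => conj (φ e) * φ' e) (N := G.dist o u')
    hG hEn hκ hreg
    (fun e => by
      rw [h.apply_symm hG hε, h'.apply_symm hG hε, map_mul, map_neg, conj_sign hε]
      linear_combination (conj (φ e) * φ' e) * sign_mul_self hε)
    (fun e hd _ => by rw [hzero e hd, mul_zero])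
    (fun e f he hf hfe hd => by
      have hne : e.fst ≠ u := by rintro h1; rw [h1] at hd; omega
      have hne' : e.fst ≠ u' := by rintro h1; rw [h1] at hd; omega
      rw [h.apply_child hG he hf hfe hne, h'.apply_child hG he hf hfe hne', map_div₀, map_mul,
        conj_sign hε, Complex.conj_natCast]
      linear_combination (conj (φ f) * φ' f / (m G o e.fst : ℂ) ^ 2) * sign_mul_self hε)
  rw [hsum.tsum_eq, hlev]
  split_ifs
  · rw [← div_div, div_eq_mul_inv _ (m G o u : ℂ)]
    ring
  · simp

lemma tsum_flow_opposite_sign (hG : G.IsTree)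
    (h : IsFlow G o En u j ε φ) (h' : IsFlow G o En u' j' ε' φ') (hε : ε = 1 ∨ ε = -1)
    (hε' : ε' = 1 ∨ ε' = -1) (hne : ε ≠ ε') :
    ∑' e : G.Dart, conj (φ e) * φ' e = 0 := by
  have hεε : ε * ε' = -1 := by
    rcases hε with rfl | rfl <;> rcases hε' with rfl | rfl <;> simp_all
  have h1 : ∑' e : G.Dart, conj (φ e) * φ' e = ∑' e : G.Dart, -(conj (φ e) * φ' e) := by
    rw [← SimpleGraph.Dart.symm_involutive.toPerm.tsum_eq]
    refine tsum_congr fun e => ?_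
    change conj (φ e.symm) * φ' e.symm = _
    rw [h.apply_symm hG hε, h'.apply_symm hG hε', map_mul, map_neg, conj_sign hε]
    linear_combination (conj (φ e) * φ' e) * hεε
  rw [tsum_neg] at h1
  exact self_eq_neg.1 h1

end pairs

/-- on the κ-regular tree (κ ≥ 3) the flow functions are pairwise
orthogonal with `⟨φ_{u,j}^(ε), φ_{u',j'}^(ε')⟩ = 2(κ−1)/(m(u)(κ−2))` iff
`(ε,u,j) = (ε',u',j')` and `0` otherwise. -/
theorem statement3 {V : Type} (G : SimpleGraph V) [∀ v : V, Fintype (G.neighborSet v)]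
    (hG : G.IsTree) [Infinite V] (o : V)
    (κ : ℕ) (hκ : 3 ≤ κ) (hreg : ∀ v : V, G.degree v = κ)
    (En : ∀ u : V, Fin (m G o u) → G.Dart) (hEn : IsChildEnum G o En)
    (Φ : V → ℕ → ℂ → G.Dart → ℂ)
    (hΦ : ∀ (u : V) (j : ℕ) (ε : ℂ), 1 ≤ j → j ≤ m G o u - 1 → (ε = 1 ∨ ε = -1) →
      IsFlow G o En u j ε (Φ u j ε)) :
    ∀ (u u' : V) (j j' : ℕ) (ε ε' : ℂ),
      1 ≤ j → j ≤ m G o u - 1 → 1 ≤ j' → j' ≤ m G o u' - 1 →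
      (ε = 1 ∨ ε = -1) → (ε' = 1 ∨ ε' = -1) →
      ∑' e : G.Dart, conj (Φ u j ε e) * Φ u' j' ε' e =
        if ε = ε' ∧ u = u' ∧ j = j' then
          (2 * ((κ : ℂ) - 1)) / ((m G o u : ℂ) * ((κ : ℂ) - 2))
        else 0 := by
  intro u u' j j' ε ε' hj0 hj hj0' hj' hε hε'
  have h := hΦ u j ε hj0 hj hε
  have h' := hΦ u' j' ε' hj0' hj' hε'
  by_cases hεε : ε = ε'
  · subst hεε
    rcases le_or_gt (G.dist o u) (G.dist o u') with hle | hlt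
    · rw [tsum_flow_same_sign hG hκ hreg hEn h h' hε (by omega) hj0' (by omega) hle]
      simp
    · have key := congrArg conj
        (tsum_flow_same_sign hG hκ hreg hEn h' h hε (by omega) hj0 (by omega) hlt.le)
      rw [Complex.conj_tsum] at key
      have hcomm (e : G.Dart) : conj (conj (Φ u' j' ε e) * Φ u j ε e) =
          conj (Φ u j ε e) * Φ u' j' ε e := by
        rw [map_mul, Complex.conj_conj, mul_comm]
      simp_rw [hcomm] at key
      rw [key]
      have hu : u ≠ u' := by
        rintro rfl
        exact lt_irrefl _ hlt
      simp [hu, hu.symm]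
  · rw [tsum_flow_opposite_sign hG h h' hε hε' hεε, if_neg fun hh => hεε hh.1]

end GroverStmt
end
end

section
/- Assume 𝕋 is rapidly branching, i.e. K(r) := inf{deg(x) : x ∈ V, dist(o, x) ≥ r} tends to ∞ as r → ∞. Then the spectrum of the Grover walk U is contained in the closure of the set of eigenvalues of U; every λ ∈ σ(U) with λ ∉ {1, −1, i, −i} is an eigenvalue of U of finite multiplicity; and 1 and −1 are eigenvalues of U of infinite multiplicity. -/
/- Setting: 𝕋 = (V,A) an infinite, locally finite tree. Vertices `V`, arcs = darts of a
simple graph `G`; `e.fst` = origin, `e.snd` = terminus, `e.symm` = reversed arc.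
ℓ²(A) and ℓ²(V) are the `lp _ 2` spaces. The boundary operators, the shift and the
Grover walk are characterized by their pointwise formulas. -/

noncomputable section
open scoped ComplexConjugate ComplexInnerProductSpace Classical
open Complex Filter Topology ContinuousLinearMap

namespace GroverStmt

variable {V : Type} (G : SimpleGraph V)

variable (o : V)

section Hilbert
variable {H : Type*} [NormedAddCommGroup H] [InnerProductSpace ℂ H]

lemma finiteDimensional_eigenspace_of_compact_factor {U K B : H →L[ℂ] H} {lam mu : ℂ}
    (hK : IsCompactOperator K) (hmu : mu ≠ 0) (hfac : K - mu • 1 = B ∘L (U - lam • 1)) :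
    FiniteDimensional ℂ (Module.End.eigenspace U.toLinearMap lam) := by
  have hKx : ∀ x ∈ Module.End.eigenspace U.toLinearMap lam, K x = mu • x := by
    intro x hx
    rw [Module.End.mem_eigenspace_iff] at hx
    have h := congrArg (fun T : H →L[ℂ] H => T x) hfac
    have hx' : U x = lam • x := hx
    simpa [hx', sub_eq_zero] using h
  have hmem : ∀ x ∈ Module.End.eigenspace U.toLinearMap lam,
      K.toLinearMap x ∈ Module.End.eigenspace U.toLinearMap lam := by
    intro x hx
    have : K.toLinearMap x = mu • x := hKx x hx
    rw [this]
    exact Submodule.smul_mem _ _ hx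
  have hclosed : IsClosed (Module.End.eigenspace U.toLinearMap lam : Set H) := by
    have : (Module.End.eigenspace U.toLinearMap lam : Set H) = {x | U x = lam • x} := by
      ext x
      simp
    rw [this]
    exact isClosed_eq U.continuous (continuous_const_smul lam)
  have hc := (IsCompactOperator.restrict (f := K.toLinearMap) hK hmem hclosed).smul mu⁻¹
  apply FiniteDimensional.of_isCompactOperator_id (𝕜 := ℂ)
  have he : (id : Module.End.eigenspace U.toLinearMap lam → _) =
      mu⁻¹ • ⇑(K.toLinearMap.restrict hmem) := by
    ext x
    have := hKx x x.2
    simp [this, smul_smul, hmu]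
  rw [he]
  exact hc

variable [CompleteSpace H]

lemma exists_approx_eigenvector {U : H →L[ℂ] H} (hU : IsStarNormal U) {lam : ℂ}
    (hl : lam ∈ spectrum ℂ U)
    (hne : ¬ Module.End.HasEigenvalue U.toLinearMap lam) (ε : ℝ) (hε : 0 < ε) :
    ∃ x : H, ‖x‖ = 1 ∧ ‖(U - lam • 1) x‖ < ε := by
  by_contra! hcon
  apply hl
  rw [spectrum.mem_resolventSet_iff, ← IsUnit.neg_iff, neg_sub, Algebra.algebraMap_eq_smul_one]
  have hnorm : IsStarNormal (U - lam • 1) := by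
    refine ⟨?_⟩
    have h := hU.star_comm_self
    have hs : star (U - lam • (1 : H →L[ℂ] H)) = star U - conj lam • 1 := by
      simp [star_sub, star_smul]
    rw [hs]
    exact Commute.sub_left (h.sub_right ((Commute.one_right _).smul_right _))
      (((Commute.one_left _).smul_left _))
  rw [isUnit_iff_bijective, bijective_iff_dense_range_and_antilipschitz]
  constructor
  · rw [Submodule.topologicalClosure_eq_top_iff, hnorm.orthogonal_range]
    rw [Module.End.hasEigenvalue_iff, not_not] at hne
    rw [Submodule.eq_bot_iff] at hne ⊢
    intro x hx
    apply hne x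
    rw [Module.End.mem_eigenspace_iff]
    simpa [sub_eq_zero] using hx
  · rw [antilipschitzWith_iff_exists_mul_le_norm]
    refine ⟨ε, hε, fun x => ?_⟩
    by_cases hx : x = 0
    · simp [hx]
    · have h0 : 0 < ‖x‖ := norm_pos_iff.mpr hx
      have := hcon ((‖x‖⁻¹ : ℂ) • x) (by simp [norm_smul, h0.ne'])
      rw [map_smul, norm_smul] at this
      simp only [norm_inv, Complex.norm_real, norm_norm] at this
      rwa [inv_mul_eq_div, le_div_iff₀ h0] at this

lemma hasEigenvalue_of_compact_factor {U K B : H →L[ℂ] H} (hU : IsStarNormal U) {lam mu : ℂ}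
    (hK : IsCompactOperator K) (hmu : mu ≠ 0) (hfac : K - mu • 1 = B ∘L (U - lam • 1))
    (hl : lam ∈ spectrum ℂ U) : Module.End.HasEigenvalue U.toLinearMap lam := by
  by_contra hne
  choose x hx1 hx2 using fun n : ℕ =>
    exists_approx_eigenvector hU hl hne (1 / ((n : ℝ) + 1)) (by positivity)
  have hx0 : Tendsto (fun n => (U - lam • 1) (x n)) atTop (𝓝 0) :=
    squeeze_zero_norm (fun n => (hx2 n).le) tendsto_one_div_add_atTop_nhds_zero_nat
  have hKx : Tendsto (fun n => (K - mu • 1) (x n)) atTop (𝓝 0) := by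
    rw [hfac]
    have h := (B.continuous.tendsto 0).comp hx0
    rw [map_zero] at h
    exact h
  obtain ⟨C, hC, hC'⟩ := hK.image_closedBall_subset_compact 1
  obtain ⟨y, -, ψ, hψ, hψy⟩ :=
    hC.tendsto_subseq (x := fun n => K (x n)) (fun n => hC' ⟨x n, by simp [hx1], rfl⟩)
  have hxl : Tendsto (fun n => x (ψ n)) atTop (𝓝 (mu⁻¹ • y)) := by
    have := (hψy.sub (hKx.comp hψ.tendsto_atTop)).const_smul mu⁻¹
    simpa [Function.comp_def, smul_smul, hmu] using this
  have hn : ‖mu⁻¹ • y‖ = 1 :=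
    tendsto_nhds_unique hxl.norm (by simp [hx1])
  have hz : (U - lam • 1) (mu⁻¹ • y) = 0 :=
    tendsto_nhds_unique (((U - lam • 1).continuous.tendsto _).comp hxl)
      (hx0.comp hψ.tendsto_atTop)
  apply hne
  refine Module.End.hasEigenvalue_of_hasEigenvector (x := mu⁻¹ • y) ⟨?_, ?_⟩
  · rw [Module.End.mem_eigenspace_iff]
    exact sub_eq_zero.mp hz
  · intro h
    simp [h] at hn

lemma hasEigenvalue_of_isolated {U : H →L[ℂ] H} (hU : IsStarNormal U) {lam : ℂ}
    (hl : lam ∈ spectrum ℂ U) (r : ℝ) (hr : 0 < r)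
    (hiso : ∀ z ∈ spectrum ℂ U, dist z lam < r → z = lam) :
    Module.End.HasEigenvalue U.toLinearMap lam := by
  set f : ℂ → ℂ := fun z => if dist z lam < r then 1 else 0 with hf
  have hcont : ContinuousOn f (spectrum ℂ U) := by
    intro z hz
    by_cases hzr : dist z lam < r
    · have : f =ᶠ[𝓝 z] fun _ => 1 := by
        filter_upwards [Metric.isOpen_ball.mem_nhds (show z ∈ Metric.ball lam r from hzr)]
          with w hw
        simp [hf, Metric.mem_ball.mp hw]
      exact (continuousAt_const.congr this.symm).continuousWithinAt
    · have hz0 : z ≠ lam := by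
        rintro rfl
        simp [hr] at hzr
      have : f =ᶠ[𝓝[spectrum ℂ U] z] fun _ => 0 := by
        have h1 : ∀ᶠ w in 𝓝[spectrum ℂ U] z, w ≠ lam :=
          mem_nhdsWithin_of_mem_nhds (isOpen_ne.mem_nhds hz0)
        filter_upwards [h1, self_mem_nhdsWithin] with w hw hws
        simp only [hf, ite_eq_right_iff]
        intro h
        exact absurd (hiso w hws h) hw
      exact continuousWithinAt_const.congr_of_eventuallyEq this (by simp [hf, hzr])
  have hmul : (U - algebraMap ℂ _ lam) * cfc f U = 0 := by
    have h1 : U - algebraMap ℂ _ lam = cfc (fun z => z - lam) U := by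
      rw [cfc_sub (fun z => z) (fun _ => lam) U, cfc_id' ℂ U, cfc_const lam U]
    rw [h1, ← cfc_mul _ _ U, ← cfc_zero ℂ U]
    apply cfc_congr
    intro z hz
    by_cases hzr : dist z lam < r
    · simp [hiso z hz hzr]
    · simp [hf, hzr]
  have hne : cfc f U ≠ 0 := by
    intro h
    have h1 : (1 : ℂ) ∈ spectrum ℂ (cfc f U) := by
      rw [cfc_map_spectrum f U]
      exact ⟨lam, hl, by simp [hf, hr]⟩
    rw [h] at h1
    have : Nontrivial (H →L[ℂ] H) := by
      by_contra hn
      rw [not_nontrivial_iff_subsingleton] at hn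
      exact h1 (isUnit_of_subsingleton _)
    rw [spectrum.zero_eq] at h1
    simp at h1
  obtain ⟨x, hx⟩ : ∃ x, cfc f U x ≠ 0 := by
    by_contra! h
    exact hne (ContinuousLinearMap.ext h)
  refine Module.End.hasEigenvalue_of_hasEigenvector (x := cfc f U x) ⟨?_, hx⟩
  rw [Module.End.mem_eigenspace_iff]
  have h := congrArg (fun T : H →L[ℂ] H => T x) hmul
  simpa [sub_eq_zero, Algebra.algebraMap_eq_smul_one] using h

end Hilbert
lemma grover_pow_four {A : Type*} [Ring A] {S P : A} (hS : S * S = 1) (hP : P * P = P) :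
    (S * (2 * P - 1)) ^ 4 - 1 =
      4 * (P * S * P) * S + 4 * S * (P * S * P)
        + 4 * (1 - 2 * P - 2 * (S * P * S)) * S * (P * S * P)
        + 4 * S * (P * S * P) * (1 - 2 * P - 2 * (S * P * S))
        + 16 * S * (P * S * P) * S * (P * S * P) := by
  have hS' : ∀ x, S * (S * x) = x := fun x => by rw [← mul_assoc, hS, one_mul]
  have hP' : ∀ x, P * (P * x) = P * x := fun x => by rw [← mul_assoc, hP]
  have hU : (S * (2 * P - 1)) * (S * (2 * P - 1)) =
      (1 - 2 * P - 2 * (S * P * S)) + 4 * S * (P * S * P) := by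
    have : (S * (2 * P - 1)) * (S * (2 * P - 1)) =
      S * S - 2 * (S * S * P) - 2 * (S * P * S) + 4 * (S * P * S * P) := by noncomm_ring
    rw [this, hS]
    have : S * (P * S * P) = S * P * S * P := by noncomm_ring
    rw [mul_assoc 4, this]
    noncomm_ring
  have hW : (1 - 2 * P - 2 * (S * P * S)) * (1 - 2 * P - 2 * (S * P * S)) =
      1 + 4 * (P * S * P) * S + 4 * S * (P * S * P) := by
    have : (1 - 2 * P - 2 * (S * P * S)) * (1 - 2 * P - 2 * (S * P * S)) =
      1 - 4 * P + 4 * (P * P) - 4 * (S * P * S) + 4 * (S * P * (S * S) * P * S)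
        + 4 * (P * S * P) * S + 4 * S * (P * S * P) := by noncomm_ring
    have h2 : S * P * 1 * P * S = S * (P * P) * S := by noncomm_ring
    rw [this, hS, h2, hP]
    noncomm_ring
  rw [show (4 : ℕ) = 2 * 2 from rfl, pow_mul, pow_two, pow_two, hU, add_mul, mul_add, mul_add, hW]
  noncomm_ring

section Lp
variable {ι κ : Type*}

lemma sum_pull_le (g : κ → ι) (w : κ → ℂ) (c : ℝ) (hw : ∀ k, ‖w k‖ ≤ c)
    (hinj : ∀ k k', w k ≠ 0 → w k' ≠ 0 → g k = g k' → k = k')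
    (f : lp (fun _ : ι => ℂ) 2) (s : Finset κ) :
    ∑ k ∈ s, ‖w k * f (g k)‖ ^ (2 : ENNReal).toReal ≤ (c * ‖f‖) ^ (2 : ENNReal).toReal := by
  have h2 : (2 : ENNReal).toReal = 2 := by simp
  calc ∑ k ∈ s, ‖w k * f (g k)‖ ^ (2 : ENNReal).toReal
      = ∑ k ∈ s with w k ≠ 0, ‖w k * f (g k)‖ ^ (2 : ENNReal).toReal := by
        rw [Finset.sum_filter_of_ne]
        intro k _ h h0
        simp [h0] at h
    _ ≤ ∑ k ∈ s with w k ≠ 0, c ^ 2 * ‖f (g k)‖ ^ (2 : ENNReal).toReal := by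
        refine Finset.sum_le_sum fun k _ => ?_
        simp only [h2, Real.rpow_two, norm_mul, mul_pow]
        gcongr
        exact hw k
    _ = c ^ 2 * ∑ i ∈ (s.filter (w · ≠ 0)).image g, ‖f i‖ ^ (2 : ENNReal).toReal := by
        rw [Finset.sum_image, Finset.mul_sum]
        intro k hk k' hk' h
        exact hinj k k' (by simpa using (Finset.mem_filter.mp hk).2)
          (by simpa using (Finset.mem_filter.mp hk').2) h
    _ ≤ c ^ 2 * ‖f‖ ^ (2 : ENNReal).toReal := by
        gcongr
        exact lp.sum_rpow_le_norm_rpow (by simp) f _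
    _ = (c * ‖f‖) ^ (2 : ENNReal).toReal := by
        simp [mul_pow]

/-- The weighted composition operator `f ↦ w · (f ∘ g)` on `ℓ²`, for a bounded weight `w` on whose
support `g` is injective. -/
def pull (g : κ → ι) (w : κ → ℂ) (c : ℝ) (hw : ∀ k, ‖w k‖ ≤ c)
    (hinj : ∀ k k', w k ≠ 0 → w k' ≠ 0 → g k = g k' → k = k') (hc : 0 ≤ c) :
    lp (fun _ : ι => ℂ) 2 →L[ℂ] lp (fun _ : κ => ℂ) 2 :=
  LinearMap.mkContinuous
    { toFun := fun f => ⟨fun k => w k * f (g k), memℓp_gen' (sum_pull_le g w c hw hinj f)⟩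
      map_add' := fun f f' => by
        ext k
        exact mul_add (w k) (f (g k)) (f' (g k))
      map_smul' := fun a f => by
        ext k
        simp only [lp.coeFn_smul, Pi.smul_apply, smul_eq_mul, RingHom.id_apply]
        ring }
    c (fun f => lp.norm_le_of_forall_sum_le (by simp) (by positivity)
      (sum_pull_le g w c hw hinj f))

lemma pull_apply (g : κ → ι) (w : κ → ℂ) (c : ℝ) (hw : ∀ k, ‖w k‖ ≤ c)
    (hinj : ∀ k k', w k ≠ 0 → w k' ≠ 0 → g k = g k' → k = k') (hc : 0 ≤ c)
    (f : lp (fun _ : ι => ℂ) 2) (k : κ) : pull g w c hw hinj hc f k = w k * f (g k) := rfl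

lemma norm_pull_le (g : κ → ι) (w : κ → ℂ) (c : ℝ) (hw : ∀ k, ‖w k‖ ≤ c)
    (hinj : ∀ k k', w k ≠ 0 → w k' ≠ 0 → g k = g k' → k = k') (hc : 0 ≤ c) :
    ‖pull g w c hw hinj hc‖ ≤ c :=
  LinearMap.mkContinuous_norm_le _ hc _

/-- The diagonal operator `f ↦ w · f` on `ℓ²` for a bounded weight `w`. -/
def diag (w : ι → ℂ) (c : ℝ) (hw : ∀ k, ‖w k‖ ≤ c) (hc : 0 ≤ c) :
    lp (fun _ : ι => ℂ) 2 →L[ℂ] lp (fun _ : ι => ℂ) 2 :=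
  pull id w c hw (fun _ _ _ _ h => h) hc

lemma isCompactOperator_of_finite_support (w : ι → ℂ) (c : ℝ) (hw : ∀ k, ‖w k‖ ≤ c)
    (hc : 0 ≤ c) (s : Finset ι) (hs : ∀ i ∉ s, w i = 0) : IsCompactOperator (diag w c hw hc) := by
  have hsum : diag w c hw hc = ∑ i ∈ s, (w i) •
      ((lp.singleContinuousLinearMap ℂ (fun _ : ι => ℂ) 2 i) ∘L
        (innerSL ℂ (lp.single 2 i (1 : ℂ) : lp (fun _ : ι => ℂ) 2))) := by
    ext f j
    rw [diag, pull_apply]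
    simp only [_root_.sum_apply, lp.coeFn_sum, Finset.sum_apply]
    simp [lp.inner_single_left, Pi.single_apply]
    by_cases hj : j ∈ s
    · simp [hj]
    · simp [hj, hs j hj]
  rw [hsum]
  refine (Submodule.sum_mem (compactOperator (RingHom.id ℂ) (lp (fun _ : ι => ℂ) 2)
    (lp (fun _ : ι => ℂ) 2)) fun i _ => Submodule.smul_mem _ _ ?_ :)
  exact (isCompactOperator_of_locallyCompactSpace_dom
    (innerSL ℂ (lp.single 2 i (1 : ℂ) : lp (fun _ : ι => ℂ) 2))).clm_comp
      (lp.singleContinuousLinearMap ℂ (fun _ : ι => ℂ) 2 i)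

lemma isCompactOperator_diag (w : ι → ℂ) (c : ℝ) (hw : ∀ k, ‖w k‖ ≤ c) (hc : 0 ≤ c)
    (hfin : ∀ ε : ℝ, 0 < ε → {i | ε < ‖w i‖}.Finite) : IsCompactOperator (diag w c hw hc) := by
  have key : ∀ n : ℕ, ∃ F : lp (fun _ : ι => ℂ) 2 →L[ℂ] lp (fun _ : ι => ℂ) 2,
      IsCompactOperator F ∧ ‖F - diag w c hw hc‖ ≤ 1 / ((n : ℝ) + 1) := by
    intro n
    set ε : ℝ := 1 / ((n : ℝ) + 1)
    have hε : 0 < ε := by positivity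
    refine ⟨diag (fun i => if ε < ‖w i‖ then w i else 0) c ?_ hc,
      isCompactOperator_of_finite_support _ _ _ _ (hfin ε hε).toFinset ?_, ?_⟩
    · intro i
      split_ifs
      · exact hw i
      · simpa using hc
    · intro i hi
      rw [Set.Finite.mem_toFinset] at hi
      exact if_neg hi
    · have : ∀ i, ‖(if ε < ‖w i‖ then 0 else -w i)‖ ≤ ε := by
        intro i
        split_ifs with h
        · simpa using hε.le
        · simpa using h
      convert norm_pull_le id _ ε this (fun _ _ _ _ h => h) hε.le using 2
      ext f i
      simp only [diag, _root_.sub_apply, lp.coeFn_sub, Pi.sub_apply, pull_apply]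
      split_ifs <;> simp
  choose F hF hF' using key
  refine isCompactOperator_of_tendsto (l := atTop) (F := F) ?_ (Eventually.of_forall hF)
  rw [tendsto_iff_norm_sub_tendsto_zero]
  exact squeeze_zero (fun _ => norm_nonneg _) hF' tendsto_one_div_add_atTop_nhds_zero_nat

end Lp
section Tree
variable {G} {o}

lemma exists_parent (hG : G.IsTree) {v : V} (hv : v ≠ o) :
    ∃ u, G.Adj u v ∧ G.dist o v = G.dist o u + 1 := by
  obtain ⟨p, hp⟩ := hG.connected.exists_walk_length_eq_dist o v
  have hnil : ¬ p.Nil := SimpleGraph.Walk.not_nil_of_ne (Ne.symm hv)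
  have hadj := p.adj_penultimate hnil
  refine ⟨p.penultimate, hadj, ?_⟩
  have h1 := SimpleGraph.dist_le p.dropLast
  have h2 := p.length_dropLast_add_one hnil
  rcases hG.dist_eq_dist_add_one_of_adj o hadj with h | h <;> omega

lemma parent_unique_s10 (hG : G.IsTree) {u u' v : V} (hu : G.Adj u v)
    (hud : G.dist o v = G.dist o u + 1) (hu' : G.Adj u' v)
    (hud' : G.dist o v = G.dist o u' + 1) : u = u' := by
  obtain ⟨p, hp⟩ := hG.connected.exists_walk_length_eq_dist o u
  obtain ⟨q, hq⟩ := hG.connected.exists_walk_length_eq_dist o u'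
  have h1 : (p.concat hu).IsPath :=
    SimpleGraph.Walk.isPath_of_length_eq_dist _ (by rw [SimpleGraph.Walk.length_concat]; omega)
  have h2 : (q.concat hu').IsPath :=
    SimpleGraph.Walk.isPath_of_length_eq_dist _ (by rw [SimpleGraph.Walk.length_concat]; omega)
  have := (hG.existsUnique_path o v).unique h1 h2
  have h3 := congrArg SimpleGraph.Walk.penultimate this
  simpa using h3

variable (G o) in
/-- The parent of `v` in the tree rooted at `o` (junk value `o` at the root). -/
def par (v : V) : V :=
  if h : ∃ u, G.Adj u v ∧ G.dist o v = G.dist o u + 1 then h.choose else o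

lemma par_spec (hG : G.IsTree) {v : V} (hv : v ≠ o) :
    G.Adj (par G o v) v ∧ G.dist o v = G.dist o (par G o v) + 1 := by
  rw [par, dif_pos (exists_parent hG hv)]
  exact (exists_parent hG hv).choose_spec

lemma ne_root_of_dist {u v : V} (h : G.dist o v = G.dist o u + 1) : v ≠ o := by
  rintro rfl
  simp at h

lemma par_eq (hG : G.IsTree) {u v : V} (hu : G.Adj u v)
    (hud : G.dist o v = G.dist o u + 1) : par G o v = u :=
  parent_unique_s10 hG (par_spec hG (ne_root_of_dist hud)).1 (par_spec hG (ne_root_of_dist hud)).2 hu hud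

variable (o) in
/-- Arcs pointing away from the root. -/
def IsDown (e : G.Dart) : Prop := G.dist o e.snd = G.dist o e.fst + 1

lemma isDown_symm_iff (hG : G.IsTree) (e : G.Dart) : IsDown o e.symm ↔ ¬ IsDown o e := by
  have := hG.dist_eq_dist_add_one_of_adj o e.adj
  simp only [IsDown, SimpleGraph.Dart.symm_toProd, Prod.fst_swap, Prod.snd_swap]
  omega

lemma IsDown.ext_of_snd_eq (hG : G.IsTree) {e e' : G.Dart} (he : IsDown o e) (he' : IsDown o e')
    (h : e.snd = e'.snd) : e = e' := by
  have h1 := e.adj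
  have h2 := he
  rw [IsDown] at h2
  rw [h] at h1 h2
  have := parent_unique_s10 hG h1 h2 e'.adj he'
  exact SimpleGraph.Dart.ext _ _ (Prod.ext this h)

variable [∀ v : V, Fintype (G.neighborSet v)]

variable (o) in
lemma finite_ball (hG : G.IsTree) (n : ℕ) : {v | G.dist o v ≤ n}.Finite := by
  induction n with
  | zero =>
    refine (Set.finite_singleton o).subset fun v hv => ?_
    have h0 : G.dist o v = 0 := Nat.le_zero.mp hv
    exact (hG.connected.dist_eq_zero_iff.mp h0).symm
  | succ n ih =>
    refine ((Set.finite_singleton o).union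
      (ih.biUnion fun u _ => (G.neighborSet u).toFinite)).subset fun v hv => ?_
    by_cases hvo : v = o
    · exact Or.inl hvo
    · obtain ⟨h1, h2⟩ := par_spec hG hvo
      refine Or.inr (Set.mem_biUnion (x := par G o v) ?_ h1)
      have : G.dist o v ≤ n + 1 := hv
      change G.dist o (par G o v) ≤ n
      omega

lemma degree_pos_of_tree (hG : G.IsTree) [Infinite V] (v : V) : 0 < G.degree v :=
  hG.connected.preconnected.degree_pos_of_nontrivial v

variable (G) in
lemma tsum_arcs_into (F : V → V → ℂ) (u : V) :
    ∑' e : {e : G.Dart // e.snd = u}, F e.1.fst e.1.snd = ∑ v ∈ G.neighborFinset u, F v u := by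
  let φ : {v // v ∈ G.neighborFinset u} ≃ {e : G.Dart // e.snd = u} :=
    { toFun := fun v => ⟨⟨(v.1, u), ((G.mem_neighborFinset u v.1).mp v.2).symm⟩, rfl⟩
      invFun := fun e => ⟨e.1.fst, by
        have h := e.1.adj.symm
        rw [e.2] at h
        exact (G.mem_neighborFinset u _).mpr h⟩
      left_inv := fun v => rfl
      right_inv := by
        rintro ⟨⟨⟨a, b⟩, h⟩, rfl⟩
        rfl }
  rw [← φ.tsum_eq, tsum_fintype]
  exact Finset.sum_coe_sort (G.neighborFinset u) fun v => F v u

end Tree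

section Operators
variable {G} {o}
lemma shift_comp_shift {S : lA G →L[ℂ] lA G} (hS : IsShift G S) : S * S = 1 := by
  ext f e
  have hS' : ∀ (ψ : lA G) (e : G.Dart), S ψ e = ψ e.symm := hS
  change S (S f) e = f e
  rw [hS', hS', SimpleGraph.Dart.symm_symm]

lemma adjoint_shift {S : lA G →L[ℂ] lA G} (hS : IsShift G S) : adjoint S = S := by
  symm
  rw [eq_adjoint_iff]
  intro x y
  rw [lp.inner_eq_tsum, lp.inner_eq_tsum]
  rw [← (Function.Involutive.toPerm _ (SimpleGraph.Dart.symm_involutive (G := G))).tsum_eq]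
  refine tsum_congr fun e => ?_
  have hS' : ∀ (ψ : lA G) (e : G.Dart), S ψ e = ψ e.symm := hS
  simp [hS']

variable [∀ v : V, Fintype (G.neighborSet v)]

lemma adjoint_boundary_apply {dT : lA G →L[ℂ] lV V} (hdT : IsBoundaryT G dT) (f : lV V)
    (e : G.Dart) : adjoint dT f e = f e.snd / (Real.sqrt (G.degree e.snd) : ℂ) := by
  have hs : dT (lp.single 2 e (1 : ℂ)) =
      lp.single 2 e.snd (1 / (Real.sqrt (G.degree e.snd) : ℂ)) := by
    ext u
    rw [hdT]
    by_cases h : e.snd = u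
    · subst h
      rw [tsum_eq_single ⟨e, rfl⟩]
      · simp
      · rintro ⟨e', he'⟩ hne
        have : e' ≠ e := fun h => hne (Subtype.ext h)
        simp [this]
    · rw [lp.single_apply_ne _ _ _ (Ne.symm h)]
      refine (tsum_congr ?_).trans tsum_zero
      rintro ⟨e', he'⟩
      have : e' ≠ e := by
        rintro rfl
        exact h he'
      simp [this]
  have h1 : inner ℂ (lp.single 2 e (1 : ℂ) : lA G) (adjoint dT f) = adjoint dT f e := by
    rw [lp.inner_single_left]
    simp
  rw [← h1, adjoint_inner_right, hs, lp.inner_single_left]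
  simp [div_eq_mul_inv]

lemma boundary_comp_adjoint (hG : G.IsTree) [Infinite V] {dT : lA G →L[ℂ] lV V}
    (hdT : IsBoundaryT G dT) : dT ∘L adjoint dT = 1 := by
  ext f u
  rw [ContinuousLinearMap.comp_apply, hdT]
  simp_rw [adjoint_boundary_apply hdT]
  have := tsum_arcs_into G (fun _ v => f v / (Real.sqrt (G.degree v) : ℂ) /
    (Real.sqrt (G.degree u) : ℂ)) u
  rw [this, Finset.sum_const, SimpleGraph.card_neighborFinset_eq_degree]
  have hd : (0 : ℝ) < G.degree u := by exact_mod_cast degree_pos_of_tree hG u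
  have h2 : (Real.sqrt (G.degree u) : ℂ) * (Real.sqrt (G.degree u) : ℂ) = (G.degree u : ℂ) := by
    rw [← Complex.ofReal_mul, Real.mul_self_sqrt hd.le]
    simp
  have hd' : (G.degree u : ℂ) ≠ 0 := by exact_mod_cast hd.ne'
  rw [div_div, h2, nsmul_eq_mul, mul_div_cancel₀ _ hd']
  rfl

/-- The part of `d_T*` living on arcs pointing away from the root. -/
lemma exists_down_part (hG : G.IsTree) [Infinite V]
    (hrb : ∀ c : ℕ, ∃ r : ℕ, ∀ x : V, r ≤ G.dist o x → c ≤ G.degree x) :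
    ∃ M : lV V →L[ℂ] lA G, IsCompactOperator M ∧ IsCompactOperator (adjoint M) ∧
      ∀ f e, M f e = if IsDown o e then f e.snd / (Real.sqrt (G.degree e.snd) : ℂ) else 0 := by
  let w : V → ℂ := fun v => ((1 / Real.sqrt (G.degree v) : ℝ) : ℂ)
  have hwn : ∀ v, ‖w v‖ = 1 / Real.sqrt (G.degree v) := fun v => by
    simp only [w, Complex.norm_real, Real.norm_eq_abs]
    exact abs_of_nonneg (by positivity)
  have hw : ∀ v, ‖w v‖ ≤ 1 := fun v => by
    rw [hwn]
    have : (1 : ℝ) ≤ G.degree v := by exact_mod_cast degree_pos_of_tree hG v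
    rw [div_le_one (by positivity)]
    exact Real.one_le_sqrt.mpr this
  let D := diag w 1 hw zero_le_one
  have hD : IsCompactOperator D := by
    refine isCompactOperator_diag w 1 hw zero_le_one fun ε hε => ?_
    obtain ⟨c, hc⟩ := exists_nat_gt ((1 / ε) ^ 2)
    obtain ⟨r, hr⟩ := hrb c
    refine (finite_ball o hG r).subset fun v hv => ?_
    by_contra hvr
    have h1 : c ≤ G.degree v := hr v (by simp only [Set.mem_ofPred_eq] at hvr; omega)
    have h2 : (c : ℝ) ≤ G.degree v := by exact_mod_cast h1
    have h3 : 1 / ε < Real.sqrt (G.degree v) := Real.lt_sqrt_of_sq_lt (hc.trans_le h2)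
    have h4 : ε < 1 / Real.sqrt (G.degree v) := (hwn v) ▸ hv
    have h5 : 0 < Real.sqrt (G.degree v) := lt_trans (by positivity) h3
    rw [lt_div_iff₀ h5] at h4
    rw [div_lt_iff₀ hε] at h3
    linarith
  have hDadj : adjoint D = D := by
    symm
    rw [eq_adjoint_iff]
    intro x y
    rw [lp.inner_eq_tsum, lp.inner_eq_tsum]
    refine tsum_congr fun v => ?_
    simp only [D, diag, pull_apply, w, id]
    simp only [RCLike.inner_apply, map_mul, Complex.conj_ofReal]
    ring
  let J : lV V →L[ℂ] lA G := pull (fun e : G.Dart => e.snd) (fun e => if IsDown o e then 1 else 0) 1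
    (fun e => by split_ifs <;> simp)
    (fun e e' he he' h => IsDown.ext_of_snd_eq hG (by simpa using he) (by simpa using he') h)
    zero_le_one
  refine ⟨J ∘L D, hD.clm_comp J, ?_, fun f e => ?_⟩
  · rw [adjoint_comp, hDadj]
    exact hD.comp_clm (adjoint J)
  · rw [ContinuousLinearMap.comp_apply]
    simp only [J, D, diag, pull_apply, w, id]
    split_ifs
    · push_cast
      ring
    · simp

lemma isCompactOperator_transition (hG : G.IsTree) [Infinite V]
    (hrb : ∀ c : ℕ, ∃ r : ℕ, ∀ x : V, r ≤ G.dist o x → c ≤ G.degree x)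
    {dT : lA G →L[ℂ] lV V} {S : lA G →L[ℂ] lA G} (hdT : IsBoundaryT G dT) (hS : IsShift G S) :
    IsCompactOperator (dT ∘L S ∘L adjoint dT) := by
  obtain ⟨M, hM, hM', hMap⟩ := exists_down_part (o := o) hG hrb
  have hS' : ∀ (ψ : lA G) (e : G.Dart), S ψ e = ψ e.symm := hS
  set R := adjoint dT with hR
  have hdTR : dT = adjoint R := by rw [hR, adjoint_adjoint]
  have h1 : adjoint M ∘L S ∘L M = 0 := by
    refine ContinuousLinearMap.ext fun x => ext_inner_left ℂ fun y => ?_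
    rw [ContinuousLinearMap.comp_apply, adjoint_inner_right, lp.inner_eq_tsum]
    simp only [ContinuousLinearMap.comp_apply, hMap, _root_.zero_apply, inner_zero_right]
    refine (tsum_congr fun e => ?_).trans tsum_zero
    rw [hS']
    simp only [hMap, isDown_symm_iff hG]
    split_ifs <;> simp
  have h2 : adjoint (R - M) ∘L S ∘L (R - M) = 0 := by
    refine ContinuousLinearMap.ext fun x => ext_inner_left ℂ fun y => ?_
    rw [ContinuousLinearMap.comp_apply, adjoint_inner_right, lp.inner_eq_tsum]
    simp only [ContinuousLinearMap.comp_apply, _root_.sub_apply, lp.coeFn_sub, Pi.sub_apply,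
      hMap, hR, adjoint_boundary_apply hdT, _root_.zero_apply, inner_zero_right]
    refine (tsum_congr fun e => ?_).trans tsum_zero
    rw [hS']
    simp only [lp.coeFn_sub, Pi.sub_apply, hMap, isDown_symm_iff hG, adjoint_boundary_apply hdT]
    split_ifs <;> simp
  have h3 : dT ∘L S ∘L R = (dT ∘L S) ∘L M + adjoint M ∘L (S ∘L R) := by
    rw [map_sub, ← hdTR] at h2
    simp only [ContinuousLinearMap.comp_sub, ContinuousLinearMap.sub_comp, h1] at h2
    rw [sub_zero, sub_sub, sub_eq_zero] at h2
    rw [h2, ContinuousLinearMap.comp_assoc, add_comm]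
  rw [h3]
  exact (hM.clm_comp (dT ∘L S)).add (hM'.comp_clm (S ∘L R))

end Operators

section Spectrum
variable {G} {o}

lemma grover_eq (S : lA G →L[ℂ] lA G) (dT : lA G →L[ℂ] lV V) :
    grover G S dT = S * (2 * (adjoint dT ∘L dT) - 1) := by
  rw [grover, two_smul, two_mul]
  rfl

variable [∀ v : V, Fintype (G.neighborSet v)]

lemma projection_mul_self (hG : G.IsTree) [Infinite V] {dT : lA G →L[ℂ] lV V}
    (hdT : IsBoundaryT G dT) :
    (adjoint dT ∘L dT) * (adjoint dT ∘L dT) = adjoint dT ∘L dT := by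
  ext f : 1
  change adjoint dT ((dT ∘L adjoint dT) (dT f)) = adjoint dT (dT f)
  rw [boundary_comp_adjoint hG hdT]
  rfl

lemma isStarNormal_grover (hG : G.IsTree) [Infinite V]
    {dT : lA G →L[ℂ] lV V} {S : lA G →L[ℂ] lA G} (hdT : IsBoundaryT G dT) (hS : IsShift G S) :
    IsStarNormal (grover G S dT) := by
  have hP := projection_mul_self hG hdT
  have hPs : star (adjoint dT ∘L dT) = adjoint dT ∘L dT := by
    rw [star_eq_adjoint, adjoint_comp, adjoint_adjoint]
  have hSs : star S = S := by rw [star_eq_adjoint, adjoint_shift hS]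
  have hSS := shift_comp_shift hS
  rw [grover_eq]
  generalize adjoint dT ∘L dT = P at *
  have hQ : (2 * P - 1) * (2 * P - 1) = 1 := by
    have : (2 * P - 1) * (2 * P - 1) = 4 * (P * P) - 4 * P + 1 := by noncomm_ring
    rw [this, hP]
    noncomm_ring
  have hQs : star (2 * P - 1) = 2 * P - 1 := by
    rw [star_sub, star_one, two_mul, star_add, hPs]
  refine ⟨?_⟩
  rw [star_mul, hQs, hSs, Commute, SemiconjBy]
  calc (2 * P - 1) * S * (S * (2 * P - 1)) = (2 * P - 1) * (S * S) * (2 * P - 1) := by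
        simp only [mul_assoc]
    _ = S * ((2 * P - 1) * (2 * P - 1)) * S := by
        rw [hSS, mul_one, hQ, mul_one, hSS]
    _ = S * (2 * P - 1) * ((2 * P - 1) * S) := by simp only [mul_assoc]

lemma isCompactOperator_grover_pow_four (hG : G.IsTree) [Infinite V]
    (hrb : ∀ c : ℕ, ∃ r : ℕ, ∀ x : V, r ≤ G.dist o x → c ≤ G.degree x)
    {dT : lA G →L[ℂ] lV V} {S : lA G →L[ℂ] lA G} (hdT : IsBoundaryT G dT) (hS : IsShift G S) :
    IsCompactOperator (grover G S dT ^ 4 - 1 : lA G →L[ℂ] lA G) := by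
  rw [grover_eq, grover_pow_four (shift_comp_shift hS) (projection_mul_self hG hdT)]
  have hC : IsCompactOperator
      ((adjoint dT ∘L dT) * S * (adjoint dT ∘L dT) : lA G →L[ℂ] lA G) :=
    ((isCompactOperator_transition hG hrb hdT hS).clm_comp (adjoint dT)).comp_clm dT
  generalize (adjoint dT ∘L dT) * S * (adjoint dT ∘L dT) = C at *
  have hl : ∀ A B : lA G →L[ℂ] lA G, IsCompactOperator B → IsCompactOperator (A * B) :=
    fun A B h => h.clm_comp A
  have hr : ∀ A B : lA G →L[ℂ] lA G, IsCompactOperator A → IsCompactOperator (A * B) :=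
    fun A B h => h.comp_clm B
  have ha : ∀ A B : lA G →L[ℂ] lA G, IsCompactOperator A → IsCompactOperator B →
    IsCompactOperator (A + B) := fun A B h h' => h.add h'
  exact ha _ _ (ha _ _ (ha _ _ (ha _ _ (hr _ _ (hl _ _ hC)) (hl _ _ hC)) (hl _ _ hC))
    (hr _ _ (hl _ _ hC))) (hl _ _ hC)

lemma exists_pow_four_sub_factor {R : Type*} [Ring R] [Algebra ℂ R] (U : R) (lam : ℂ) :
    ∃ B : R, (U ^ 4 - 1) - (lam ^ 4 - 1) • 1 = B * (U - lam • 1) := by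
  have h : Commute U (lam • 1) := (Commute.one_right U).smul_right lam
  refine ⟨_, Eq.trans ?_ (h.geom_sum₂_mul 4).symm⟩
  rw [smul_pow, one_pow, sub_smul, one_smul]
  abel

lemma grover_eigenvalue (hG : G.IsTree) [Infinite V]
    (hrb : ∀ c : ℕ, ∃ r : ℕ, ∀ x : V, r ≤ G.dist o x → c ≤ G.degree x)
    {dT : lA G →L[ℂ] lV V} {S : lA G →L[ℂ] lA G} (hdT : IsBoundaryT G dT) (hS : IsShift G S)
    {lam : ℂ} (hl : lam ∈ spectrum ℂ (grover G S dT))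
    (hne : lam ∉ ({1, -1, Complex.I, -Complex.I} : Set ℂ)) :
    Module.End.HasEigenvalue (grover G S dT).toLinearMap lam ∧
      FiniteDimensional ℂ (Module.End.eigenspace (grover G S dT).toLinearMap lam) := by
  have hmu : lam ^ 4 - 1 ≠ 0 := by
    intro h
    apply hne
    have h1 : (lam - 1) * ((lam + 1) * ((lam - I) * (lam + I))) = 0 := by
      linear_combination h - (lam ^ 2 - 1) * Complex.I_sq
    simp only [mul_eq_zero, sub_eq_zero, add_eq_zero_iff_eq_neg] at h1
    simpa using h1
  have hK := isCompactOperator_grover_pow_four hG hrb hdT hS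
  obtain ⟨B, hfac⟩ := exists_pow_four_sub_factor (grover G S dT) lam
  exact ⟨hasEigenvalue_of_compact_factor (isStarNormal_grover hG hdT hS) hK hmu hfac hl,
    finiteDimensional_eigenspace_of_compact_factor hK hmu hfac⟩

end Spectrum

section Flow
variable {G} {o}
variable [∀ v : V, Fintype (G.neighborSet v)]

variable (G o) in
/-- Fuelled recursion for the flow emanating from the vertex `a`. -/
def flowAux (a : V) (ε : ℂ) : ℕ → V → ℂ
  | 0, _ => 0
  | n + 1, v =>
    if v = a then 1 else ε * flowAux a ε n (par G o v) / ((G.degree (par G o v) : ℂ) - 1)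

variable (G o) in
/-- The unit flow through the arc into `a`, equally divided among children with the sign `ε`
at each generation, as a function of the terminal vertex of an arc pointing away from the root. -/
def flow (a : V) (ε : ℂ) (v : V) : ℂ := flowAux G o a ε (G.dist o v) v

lemma flow_root (a : V) (ε : ℂ) : flow G o a ε o = 0 := by
  simp [flow, flowAux]

lemma flow_self (hG : G.IsTree) {a : V} (ha : a ≠ o) (ε : ℂ) : flow G o a ε a = 1 := by
  rw [flow, (par_spec hG ha).2, flowAux, if_pos rfl]

lemma flow_of_ne (hG : G.IsTree) {a v : V} (hv : v ≠ o) (hva : v ≠ a) (ε : ℂ) :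
    flow G o a ε v = ε * flow G o a ε (par G o v) / ((G.degree (par G o v) : ℂ) - 1) := by
  rw [flow, (par_spec hG hv).2, flowAux, if_neg hva]
  rfl

lemma flow_eq_zero (hG : G.IsTree) {a : V} (ε : ℂ) {v : V} (hva : v ≠ a)
    (hd : G.dist o v ≤ G.dist o a) : flow G o a ε v = 0 := by
  induction hn : G.dist o v generalizing v with
  | zero => rw [flow, hn, flowAux]
  | succ n ih =>
    have hv : v ≠ o := by
      rintro rfl
      simp at hn
    have h := (par_spec hG hv).2
    have hpa : par G o v ≠ a := by
      intro h'
      rw [h'] at h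
      omega
    rw [flow_of_ne hG hv hva, ih hpa (by omega) (by omega), mul_zero, zero_div]

lemma card_children (hG : G.IsTree) {w : V} (hw : w ≠ o) :
    ((G.neighborFinset w).filter fun v => G.dist o v = G.dist o w + 1).card
      = G.degree w - 1 := by
  have h := par_spec hG hw
  have : ((G.neighborFinset w).filter fun v => G.dist o v = G.dist o w + 1)
      = (G.neighborFinset w).erase (par G o w) := by
    ext v
    simp only [Finset.mem_filter, Finset.mem_erase, SimpleGraph.mem_neighborFinset]
    constructor
    · rintro ⟨h1, h2⟩
      refine ⟨?_, h1⟩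
      rintro rfl
      omega
    · rintro ⟨h1, h2⟩
      refine ⟨h2, ?_⟩
      rcases hG.dist_eq_dist_add_one_of_adj o h2 with h3 | h3
      · exact absurd (par_eq hG h2.symm h3).symm h1
      · exact h3
  rw [this, Finset.card_erase_of_mem (by simpa using h.1.symm),
    SimpleGraph.card_neighborFinset_eq_degree]

lemma sum_flow_children (hG : G.IsTree) {a : V} (ha : a ≠ o)
    (hdeg : ∀ x, G.dist o a ≤ G.dist o x → 3 ≤ G.degree x) (ε : ℂ) (w : V) :
    (∑ v ∈ G.neighborFinset w, if G.dist o v = G.dist o w + 1 then flow G o a ε v else 0)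
      = if w = par G o a then 1 else ε * flow G o a ε w := by
  obtain ⟨h1, h2⟩ := par_spec hG ha
  split_ifs with hw
  · subst hw
    rw [Finset.sum_eq_single a]
    · rw [if_pos h2, flow_self hG ha]
    · intro v _ hva
      split_ifs with h
      · exact flow_eq_zero hG ε hva (by omega)
      · rfl
    · intro h
      exact absurd ((G.mem_neighborFinset _ _).mpr h1) h
  · have hc : ∀ v ∈ (G.neighborFinset w).filter fun v => G.dist o v = G.dist o w + 1,
        flow G o a ε v = ε * flow G o a ε w / ((G.degree w : ℂ) - 1) := by
      intro v hv
      simp only [Finset.mem_filter, SimpleGraph.mem_neighborFinset] at hv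
      have hp := par_eq hG hv.1 hv.2
      have hva : v ≠ a := by
        rintro rfl
        exact hw hp.symm
      rw [flow_of_ne hG (ne_root_of_dist hv.2) hva, hp]
    rw [← Finset.sum_filter, Finset.sum_congr rfl hc, Finset.sum_const, nsmul_eq_mul]
    by_cases hz : flow G o a ε w = 0
    · simp [hz]
    · have hwo : w ≠ o := by
        rintro rfl
        exact hz (flow_root a ε)
      have hda : G.dist o a ≤ G.dist o w := by
        by_contra hlt
        refine hz (flow_eq_zero hG ε ?_ (by omega))
        rintro rfl
        exact hlt le_rfl
      have h3 := hdeg w hda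
      rw [card_children hG hwo, Nat.cast_sub (by omega), Nat.cast_one]
      have : (G.degree w : ℂ) - 1 ≠ 0 := by
        rw [sub_ne_zero]
        exact_mod_cast (by omega : G.degree w ≠ 1)
      field_simp

lemma sum_norm_flow_children_le (hG : G.IsTree) {a : V}
    (hdeg : ∀ x, G.dist o a ≤ G.dist o x → 3 ≤ G.degree x) {ε : ℂ} (hε : ‖ε‖ = 1) (u : V)
    (t : Finset V) (ht : ∀ v ∈ t, v ≠ o ∧ v ≠ a ∧ par G o v = u) :
    ∑ v ∈ t, ‖flow G o a ε v‖ ^ 2 ≤ 3 / 4 * ‖flow G o a ε u‖ ^ 2 := by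
  have hc : ∀ v ∈ t, ‖flow G o a ε v‖ ^ 2 =
      ‖flow G o a ε u‖ ^ 2 / ‖(G.degree u : ℂ) - 1‖ ^ 2 := by
    intro v hv
    obtain ⟨h1, h2, h3⟩ := ht v hv
    rw [flow_of_ne hG h1 h2, h3, norm_div, norm_mul, hε, one_mul, div_pow]
  rw [Finset.sum_congr rfl hc, Finset.sum_const, nsmul_eq_mul]
  by_cases hz : flow G o a ε u = 0
  · simp [hz]
  · have hda : G.dist o a ≤ G.dist o u := by
      by_contra hlt
      refine hz (flow_eq_zero hG ε ?_ (by omega))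
      rintro rfl
      exact hlt le_rfl
    have h3 : (3 : ℝ) ≤ G.degree u := by exact_mod_cast hdeg u hda
    have hcard : (t.card : ℝ) ≤ G.degree u := by
      rw [← SimpleGraph.card_neighborFinset_eq_degree]
      refine Nat.cast_le.mpr (Finset.card_le_card fun v hv => ?_)
      obtain ⟨h1, h2, h3⟩ := ht v hv
      rw [SimpleGraph.mem_neighborFinset, ← h3]
      exact (par_spec hG h1).1
    have hn : ‖(G.degree u : ℂ) - 1‖ = (G.degree u : ℝ) - 1 := by
      have : (G.degree u : ℂ) - 1 = (((G.degree u : ℝ) - 1 : ℝ) : ℂ) := by push_cast; rfl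
      rw [this, Complex.norm_real, Real.norm_eq_abs, abs_of_nonneg (by linarith)]
    rw [hn, mul_div_assoc', div_le_iff₀ (by nlinarith)]
    have hp : 0 ≤ ‖flow G o a ε u‖ ^ 2 := sq_nonneg _
    nlinarith [mul_le_mul_of_nonneg_right
      (show (t.card : ℝ) ≤ 3 / 4 * ((G.degree u : ℝ) - 1) ^ 2 by nlinarith) hp]

lemma sum_norm_flow_le (hG : G.IsTree) {a : V} (ha : a ≠ o)
    (hdeg : ∀ x, G.dist o a ≤ G.dist o x → 3 ≤ G.degree x) {ε : ℂ} (hε : ‖ε‖ = 1) (n : ℕ) :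
    ∑ v ∈ (finite_ball o hG n).toFinset, ‖flow G o a ε v‖ ^ 2 ≤ 4 := by
  induction n with
  | zero =>
    rw [Finset.sum_eq_zero]
    · norm_num
    intro v hv
    have h0 : G.dist o v = 0 := by simpa using hv
    simp [flow, h0, flowAux]
  | succ n ih =>
    set s := (finite_ball o hG (n + 1)).toFinset
    have h1 : ∑ v ∈ s, ‖flow G o a ε v‖ ^ 2 ≤
        1 + ∑ v ∈ s.filter (fun v => v ≠ o ∧ v ≠ a), ‖flow G o a ε v‖ ^ 2 := by
      have hsub : s ⊆ {o} ∪ ({a} ∪ s.filter (fun v => v ≠ o ∧ v ≠ a)) := by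
        intro v hv
        simp only [Finset.mem_union, Finset.mem_singleton, Finset.mem_filter]
        tauto
      refine (Finset.sum_le_sum_of_subset_of_nonneg hsub fun _ _ _ => sq_nonneg _).trans ?_
      rw [Finset.sum_union (by simp [Ne.symm ha]), Finset.sum_union (by simp),
        Finset.sum_singleton, Finset.sum_singleton, flow_root, flow_self hG ha]
      simp
    have h2 : ∑ v ∈ s.filter (fun v => v ≠ o ∧ v ≠ a), ‖flow G o a ε v‖ ^ 2 ≤
        ∑ u ∈ (finite_ball o hG n).toFinset, 3 / 4 * ‖flow G o a ε u‖ ^ 2 := by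
      rw [← Finset.sum_fiberwise_of_maps_to (g := par G o)
        (t := (finite_ball o hG n).toFinset)]
      · refine Finset.sum_le_sum fun u _ =>
          sum_norm_flow_children_le hG hdeg hε u _ fun v hv => ?_
        simp only [Finset.mem_filter] at hv
        exact ⟨hv.1.2.1, hv.1.2.2, hv.2⟩
      · intro v hv
        simp only [s, Finset.mem_filter, Set.Finite.mem_toFinset, Set.mem_ofPred_eq] at hv ⊢
        have := (par_spec hG hv.2.1).2
        omega
    rw [← Finset.mul_sum] at h2
    linarith

lemma memℓp_flow (hG : G.IsTree) {a : V} (ha : a ≠ o)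
    (hdeg : ∀ x, G.dist o a ≤ G.dist o x → 3 ≤ G.degree x) {ε : ℂ} (hε : ‖ε‖ = 1) :
    Memℓp (flow G o a ε) 2 := by
  refine memℓp_gen' (C := 4) fun s => ?_
  simp only [ENNReal.toReal_ofNat, Real.rpow_ofNat]
  refine (Finset.sum_le_sum_of_subset_of_nonneg (t := (finite_ball o hG
    (s.sup fun v => G.dist o v)).toFinset) (fun v hv => ?_) fun _ _ _ => sq_nonneg _).trans
    (sum_norm_flow_le hG ha hdeg hε _)
  simpa using Finset.le_sup (f := fun v => G.dist o v) hv

lemma exists_arc_flow (hG : G.IsTree) {a : V} (ha : a ≠ o)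
    (hdeg : ∀ x, G.dist o a ≤ G.dist o x → 3 ≤ G.degree x) {ε : ℂ} (hε : ε * ε = 1)
    {dT : lA G →L[ℂ] lV V} {S : lA G →L[ℂ] lA G} (hdT : IsBoundaryT G dT) (hS : IsShift G S) :
    ∃ φ : lA G, S φ = -ε • φ ∧
      (∀ w, dT φ w = if w = par G o a then -ε / (Real.sqrt (G.degree w) : ℂ) else 0) ∧
      (∀ e, IsDown o e → e.snd = a → φ e = 1) ∧
      (∀ e, IsDown o e → e.snd ≠ a → G.dist o e.snd ≤ G.dist o a → φ e = 0) := by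
  have hεn : ‖ε‖ = 1 := by
    have h := congrArg norm hε
    rw [norm_mul, norm_one] at h
    nlinarith [norm_nonneg ε]
  have hS' : ∀ (ψ : lA G) (e : G.Dart), S ψ e = ψ e.symm := hS
  let f : lV V := ⟨flow G o a ε, memℓp_flow hG ha hdeg hεn⟩
  let J : lV V →L[ℂ] lA G := pull (fun e : G.Dart => e.snd) (fun e => if IsDown o e then 1 else 0) 1
    (fun e => by split_ifs <;> simp)
    (fun e e' he he' h => IsDown.ext_of_snd_eq hG (by simpa using he) (by simpa using he') h)
    zero_le_one
  have hJ : ∀ e, J f e = if IsDown o e then flow G o a ε e.snd else 0 := by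
    intro e
    simp only [J, pull_apply]
    split_ifs
    · exact one_mul _
    · exact zero_mul _
  have hφ : ∀ e, (J f - ε • S (J f) : lA G) e =
      if IsDown o e then flow G o a ε e.snd else -ε * flow G o a ε e.fst := by
    intro e
    simp only [lp.coeFn_sub, lp.coeFn_smul, Pi.sub_apply, Pi.smul_apply, hS', hJ,
      isDown_symm_iff hG, smul_eq_mul]
    split_ifs <;> simp
  refine ⟨J f - ε • S (J f), ?_, fun w => ?_, fun e he hea => ?_, fun e he hea hd => ?_⟩
  · have hSS : S (S (J f)) = J f := congrArg (fun T : lA G →L[ℂ] lA G => T (J f))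
      (shift_comp_shift hS)
    rw [map_sub, map_smul, hSS, smul_sub, smul_smul, neg_mul, hε]
    simp only [neg_smul, one_smul]
    abel
  · rw [hdT]
    have hφ' : ∀ e, (J f - ε • S (J f) : lA G) e =
        if G.dist o e.snd = G.dist o e.fst + 1 then flow G o a ε e.snd
        else -ε * flow G o a ε e.fst :=
      fun e => (hφ e).trans (if_congr Iff.rfl rfl rfl)
    simp only [hφ']
    refine (tsum_arcs_into G (fun v u => (if G.dist o u = G.dist o v + 1 then flow G o a ε u
      else -ε * flow G o a ε v) / (Real.sqrt (G.degree w) : ℂ)) w).trans ?_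
    have hsplit : ∀ v ∈ G.neighborFinset w,
        (if G.dist o w = G.dist o v + 1 then flow G o a ε w else -ε * flow G o a ε v) =
          (if v = par G o w then flow G o a ε w else 0) -
            ε * (if G.dist o v = G.dist o w + 1 then flow G o a ε v else 0) := by
      intro v hv
      rw [SimpleGraph.mem_neighborFinset] at hv
      rcases hG.dist_eq_dist_add_one_of_adj o hv with h | h
      · rw [if_pos h, if_pos (par_eq hG hv.symm h).symm, if_neg (by omega), mul_zero, sub_zero]
      · have hvp : v = par G o w → flow G o a ε w = 0 := by
          intro hvp
          by_cases hw : w = o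
          · rw [hw, flow_root]
          · have := (par_spec hG hw).2
            rw [← hvp] at this
            omega
        rw [if_neg (by omega), if_pos h]
        split_ifs with hvp'
        · rw [hvp hvp', zero_sub, neg_mul]
        · rw [zero_sub, neg_mul]
    have hpar : (∑ v ∈ G.neighborFinset w, if v = par G o w then flow G o a ε w else 0) =
        flow G o a ε w := by
      rw [Finset.sum_ite_eq']
      split_ifs with h
      · rfl
      · by_cases hw : w = o
        · rw [hw, flow_root]
        · exact absurd ((G.mem_neighborFinset _ _).mpr (par_spec hG hw).1.symm) h
    rw [← Finset.sum_div, Finset.sum_congr rfl hsplit, Finset.sum_sub_distrib, hpar,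
      ← Finset.mul_sum, sum_flow_children hG ha hdeg]
    split_ifs with hw
    · rw [hw, flow_eq_zero hG ε (fun h => (par_spec hG ha).1.ne h)
        (by have := (par_spec hG ha).2; omega), zero_sub, mul_one]
    · rw [← mul_assoc, hε, one_mul, sub_self, zero_div]
  · rw [hφ, if_pos he, hea, flow_self hG ha]
  · rw [hφ, if_pos he, flow_eq_zero hG ε hea hd]

end Flow

section Eigenspace
variable {G} {o}

lemma not_finiteDimensional_of_exists_deep (N : Submodule ℂ (lA G))
    (hN : ∀ r : ℕ, ∃ φ ∈ N, φ ≠ 0 ∧ ∀ e : G.Dart, G.dist o e.snd ≤ r → φ e = 0) :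
    ¬ FiniteDimensional ℂ N := by
  intro hfin
  let F : ℕ →o (Submodule ℂ N)ᵒᵈ :=
    { toFun := fun r => OrderDual.toDual
        { carrier := {φ | ∀ e : G.Dart, G.dist o e.snd ≤ r → (φ : lA G) e = 0}
          zero_mem' := fun e _ => rfl
          add_mem' := fun {x y} hx hy e he => by
            change (x : lA G) e + (y : lA G) e = 0
            rw [hx e he, hy e he, add_zero]
          smul_mem' := fun c x hx e he => by
            change c * (x : lA G) e = 0
            rw [hx e he, mul_zero] }
      monotone' := fun r r' h φ hφ e he => hφ e (he.trans h) }
  obtain ⟨n, hn⟩ := IsArtinian.monotone_stabilizes F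
  obtain ⟨φ, hφN, hφ0, hφ⟩ := hN n
  apply hφ0
  ext e
  have h1 : (⟨φ, hφN⟩ : N) ∈ OrderDual.ofDual (F n) := hφ
  rw [hn (n + G.dist o e.snd) (Nat.le_add_right _ _)] at h1
  exact h1 e (Nat.le_add_left _ _)

variable [∀ v : V, Fintype (G.neighborSet v)]

lemma exists_deep_eigenvector (hG : G.IsTree) [Infinite V]
    (hrb : ∀ c : ℕ, ∃ r : ℕ, ∀ x : V, r ≤ G.dist o x → c ≤ G.degree x)
    {ε : ℂ} (hε : ε * ε = 1)
    {dT : lA G →L[ℂ] lV V} {S : lA G →L[ℂ] lA G} (hdT : IsBoundaryT G dT) (hS : IsShift G S)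
    (r : ℕ) :
    ∃ φ ∈ Module.End.eigenspace (grover G S dT).toLinearMap ε, φ ≠ 0 ∧
      ∀ e : G.Dart, G.dist o e.snd ≤ r → φ e = 0 := by
  obtain ⟨R, hR⟩ := hrb 3
  obtain ⟨u, hu⟩ := (finite_ball o hG (r + R + 1)).infinite_compl.nonempty
  have hur : r + R + 1 < G.dist o u := not_le.mp hu
  have huo : u ≠ o := by
    rintro rfl
    simp at hur
  have hcard : 1 < ((G.neighborFinset u).filter fun v => G.dist o v = G.dist o u + 1).card := by
    have := hR u (by omega)
    rw [card_children hG huo]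
    omega
  obtain ⟨a, ha, b, hb, hab⟩ := Finset.one_lt_card.mp hcard
  simp only [Finset.mem_filter, SimpleGraph.mem_neighborFinset] at ha hb
  obtain ⟨φ, hφS, hφT, hφ1, hφ0⟩ := exists_arc_flow hG (ne_root_of_dist ha.2)
    (fun x hx => hR x (by omega)) hε hdT hS
  obtain ⟨ψ, hψS, hψT, hψ1, hψ0⟩ := exists_arc_flow hG (ne_root_of_dist hb.2)
    (fun x hx => hR x (by omega)) hε hdT hS
  rw [par_eq hG ha.1 ha.2] at hφT
  rw [par_eq hG hb.1 hb.2] at hψT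
  have hT : dT (φ - ψ) = 0 := by
    ext w
    rw [map_sub, lp.coeFn_sub, Pi.sub_apply, hφT, hψT, sub_self]
    rfl
  have hSε : S (φ - ψ) = -ε • (φ - ψ) := by rw [map_sub, hφS, hψS, smul_sub]
  have hdown : ∀ e, IsDown o e → G.dist o e.snd ≤ r + 1 → (φ - ψ) e = 0 := by
    intro e he hd
    rw [lp.coeFn_sub, Pi.sub_apply, hφ0 e he (by rintro h; rw [h] at hd; omega) (by omega),
      hψ0 e he (by rintro h; rw [h] at hd; omega) (by omega), sub_self]
  refine ⟨φ - ψ, ?_, ?_, ?_⟩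
  · rw [Module.End.mem_eigenspace_iff]
    change S ((2 : ℂ) • adjoint dT (dT (φ - ψ)) - (φ - ψ)) = ε • (φ - ψ)
    rw [hT, map_zero, smul_zero, zero_sub, map_neg, hSε, neg_smul, neg_neg]
  · intro h
    have h1 : (φ - ψ) (⟨(u, a), ha.1⟩ : G.Dart) = 0 := by rw [h]; rfl
    rw [lp.coeFn_sub, Pi.sub_apply, hφ1 ⟨(u, a), ha.1⟩ ha.2 rfl, hψ0 ⟨(u, a), ha.1⟩ ha.2 hab (by
      change G.dist o a ≤ G.dist o b
      omega)] at h1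
    simp at h1
  · intro e hd
    by_cases he : IsDown o e
    · exact hdown e he (by omega)
    · have h1 := (isDown_symm_iff hG e).mpr he
      have h2 := hdown e.symm h1 (by
        rw [h1]
        change G.dist o e.snd + 1 ≤ r + 1
        omega)
      have h3 : (φ - ψ) e.symm = (-ε • (φ - ψ) : lA G) e := by
        rw [← hSε]
        exact (hS _ e).symm
      rw [h3, lp.coeFn_smul, Pi.smul_apply, smul_eq_mul] at h2
      have hε0 : ε ≠ 0 := by
        rintro rfl
        simp at hε
      simpa [hε0] using h2

lemma hasEigenvalue_and_not_finiteDimensional (hG : G.IsTree) [Infinite V]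
    (hrb : ∀ c : ℕ, ∃ r : ℕ, ∀ x : V, r ≤ G.dist o x → c ≤ G.degree x)
    {ε : ℂ} (hε : ε * ε = 1)
    {dT : lA G →L[ℂ] lV V} {S : lA G →L[ℂ] lA G} (hdT : IsBoundaryT G dT) (hS : IsShift G S) :
    Module.End.HasEigenvalue (grover G S dT).toLinearMap ε ∧
      ¬ FiniteDimensional ℂ (Module.End.eigenspace (grover G S dT).toLinearMap ε) := by
  have h := exists_deep_eigenvector hG hrb hε hdT hS
  refine ⟨?_, not_finiteDimensional_of_exists_deep _ h⟩
  obtain ⟨φ, hφ, hφ0, -⟩ := h 0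
  exact Module.End.hasEigenvalue_of_hasEigenvector ⟨hφ, hφ0⟩

end Eigenspace



/-- if 𝕋 is rapidly branching (`K(r) = inf{deg x : dist(o,x) ≥ r} → ∞`),
then `σ(U)` is contained in the closure of the set of eigenvalues of `U`; every
`λ ∈ σ(U)` outside `{1, −1, i, −i}` is an eigenvalue of finite multiplicity; and
`1`, `−1` are eigenvalues of infinite multiplicity. -/
theorem statement10 {V : Type} (G : SimpleGraph V) [∀ v : V, Fintype (G.neighborSet v)]
    (hG : G.IsTree) [Infinite V] (o : V)
    (hrb : ∀ c : ℕ, ∃ r : ℕ, ∀ x : V, r ≤ G.dist o x → c ≤ G.degree x)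
    (dT : lA G →L[ℂ] lV V) (S : lA G →L[ℂ] lA G)
    (hdT : IsBoundaryT G dT) (hS : IsShift G S) :
    (spectrum ℂ (grover G S dT) ⊆
      closure {lam : ℂ | Module.End.HasEigenvalue (grover G S dT).toLinearMap lam}) ∧
    (∀ lam ∈ spectrum ℂ (grover G S dT),
      lam ∉ ({1, -1, Complex.I, -Complex.I} : Set ℂ) →
      Module.End.HasEigenvalue (grover G S dT).toLinearMap lam ∧
      FiniteDimensional ℂ
        (Module.End.eigenspace (grover G S dT).toLinearMap lam)) ∧
    Module.End.HasEigenvalue (grover G S dT).toLinearMap 1 ∧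
    Module.End.HasEigenvalue (grover G S dT).toLinearMap (-1) ∧
    ¬ FiniteDimensional ℂ (Module.End.eigenspace (grover G S dT).toLinearMap 1) ∧
    ¬ FiniteDimensional ℂ (Module.End.eigenspace (grover G S dT).toLinearMap (-1)) := by
  have h1 := hasEigenvalue_and_not_finiteDimensional hG hrb (ε := 1) (by norm_num) hdT hS
  have h2 := hasEigenvalue_and_not_finiteDimensional hG hrb (ε := -1) (by norm_num) hdT hS
  refine ⟨?_, fun lam hl hne => grover_eigenvalue hG hrb hdT hS hl hne, h1.1, h2.1, h1.2, h2.2⟩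
  intro lam hl
  by_contra hcl
  have hE : ¬ Module.End.HasEigenvalue (grover G S dT).toLinearMap lam :=
    fun h => hcl (subset_closure h)
  have hfin : (({1, -1, Complex.I, -Complex.I} : Set ℂ) \ {lam}).Finite :=
    (Set.toFinite _).sdiff
  have hnhds : (closure {z : ℂ | Module.End.HasEigenvalue (grover G S dT).toLinearMap z})ᶜ ∩
      (({1, -1, Complex.I, -Complex.I} : Set ℂ) \ {lam})ᶜ ∈ 𝓝 lam :=
    (isClosed_closure.isOpen_compl.inter hfin.isClosed.isOpen_compl).mem_nhds
      ⟨hcl, fun h => h.2 rfl⟩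
  obtain ⟨r, hr, hball⟩ := Metric.mem_nhds_iff.mp hnhds
  refine hE (hasEigenvalue_of_isolated (isStarNormal_grover hG hdT hS) hl r hr
    fun z hz hzr => ?_)
  obtain ⟨hz1, hz2⟩ := hball (Metric.mem_ball.mpr hzr)
  by_contra hzl
  exact hz1 (subset_closure
    (grover_eigenvalue hG hrb hdT hS hz fun h => hz2 ⟨h, hzl⟩).1)

end GroverStmt
end
end

section
/- Assume every vertex of 𝕋 has degree at least 2 (no leaves). Set B_n = |V_n|, ∂B_n = B_{n+1} − B_n, and let ρ_n^(+) and ρ_n^(−) be the densities ρ_n^(±) = dim(ker(U^(n) ∓ 1) ∩ 𝒜_{n+1}) / dim(𝒜_{n+1}). Put h₊ = limsup_{n→∞} ∂B_n/B_n and h₋ = liminf_{n→∞} ∂B_n/B_n and assume h₋ > 0 and h₊ < ∞. Then for both signs, liminf_{n→∞} ρ_n^(±) = h₋/(2(1+h₋)) > 0 and limsup_{n→∞} ρ_n^(±) = h₊/(2(1+h₊)) ≤ 1/2. In particular, if the limit h = lim_{n→∞} ∂B_n/B_n exists (and is positive and finite), then lim_{n→∞} ρ_n^(±) = h/(2(1+h)).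 -/
/- Setting: 𝕋 = (V,A) an infinite, locally finite tree. Vertices `V`, arcs = darts of a
simple graph `G`; `e.fst` = origin, `e.snd` = terminus, `e.symm` = reversed arc.
ℓ²(A) and ℓ²(V) are the `lp _ 2` spaces. The boundary operators, the shift and the
Grover walk are characterized by their pointwise formulas. -/

noncomputable section
open scoped ComplexConjugate ComplexInnerProductSpace Classical
open Complex Filter Topology ContinuousLinearMap

namespace GroverStmt

variable {V : Type} (G : SimpleGraph V)

variable (o : V)

/-- the subspace of ℓ²(A) of functions supported in a set `Aset` of arcs
(for a finite `Aset`, this is the span of the indicators `δ_e`, `e ∈ Aset`). -/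
def suppSubmodule (Aset : Set G.Dart) : Submodule ℂ (lA G) where
  carrier := {ψ : lA G | ∀ e ∉ Aset, ψ e = 0}
  add_mem' := by
    intro a b ha hb e he
    rw [lp.coeFn_add, Pi.add_apply, ha e he, hb e he, add_zero]
  zero_mem' := by
    intro e he
    rw [lp.coeFn_zero, Pi.zero_apply]
  smul_mem' := by
    intro c a ha e he
    rw [lp.coeFn_smul, Pi.smul_apply, ha e he, smul_zero]

section Graph

theorem forall_of_adj {G : SimpleGraph V} (hc : G.Connected) {p : V → Prop}
    (h : ∀ u v, G.Adj u v → p u → p v) {w : V} (hw : p w) (v : V) : p v := by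
  obtain ⟨q⟩ := hc.preconnected w v
  induction q with
  | nil => exact hw
  | cons hadj _ ih => exact ih (h _ _ hadj hw)

theorem finite_ball_s19 [∀ v : V, Fintype (G.neighborSet v)] (hc : G.Connected) (n : ℕ) :
    {v : V | G.dist o v ≤ n}.Finite := by
  induction n with
  | zero =>
    refine (Set.finite_singleton o).subset fun v hv => ?_
    have : G.dist o v = 0 := by simpa using hv
    exact ((hc.dist_eq_zero_iff).1 this).symm
  | succ n ih =>
    refine (ih.union (ih.biUnion fun u _ => (G.neighborSet u).toFinite)).subset fun v hv => ?_
    obtain ⟨w, hw⟩ := hc.exists_walk_length_eq_dist v o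
    cases w with
    | nil => left; simp
    | @cons _ u _ hadj q =>
      right
      have hq := G.dist_le q
      rw [SimpleGraph.Walk.length_cons] at hw
      have hv' : G.dist o v ≤ n + 1 := hv
      rw [SimpleGraph.dist_comm] at hv'
      refine Set.mem_biUnion (x := u) ?_ hadj.symm
      change G.dist o u ≤ n
      rw [SimpleGraph.dist_comm]
      omega

theorem exists_lt_dist [∀ v : V, Fintype (G.neighborSet v)] [Infinite V] (hc : G.Connected)
    (n : ℕ) : ∃ v, n < G.dist o v := by
  obtain ⟨v, hv⟩ := (finite_ball_s19 G o hc n).infinite_compl.nonempty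
  exact ⟨v, by simpa using hv⟩

theorem eq_of_adj_of_dist_eq {G : SimpleGraph V} (hG : G.IsTree) {u u' v : V} (hu : G.Adj u v)
    (hu' : G.Adj u' v) (h : G.dist o v = G.dist o u + 1) (h' : G.dist o v = G.dist o u' + 1) :
    u = u' := by
  obtain ⟨p, hp⟩ := hG.connected.exists_walk_length_eq_dist o u
  obtain ⟨p', hp'⟩ := hG.connected.exists_walk_length_eq_dist o u'
  have h1 : (p.concat hu).IsPath :=
    SimpleGraph.Walk.isPath_of_length_eq_dist _ (by simp [hp, h])
  have h2 : (p'.concat hu').IsPath :=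
    SimpleGraph.Walk.isPath_of_length_eq_dist _ (by simp [hp', h'])
  exact (SimpleGraph.Walk.concat_inj ((hG.existsUnique_path o v).unique h1 h2)).1

/-- The arcs of the ball of radius `n` around `o`. -/
def ballArcs (n : ℕ) : Set G.Dart := {e | G.dist o e.fst ≤ n ∧ G.dist o e.snd ≤ n}

/-- The arcs of the ball of radius `n` around `o` that point away from `o`. -/
def outArcs (n : ℕ) : Set G.Dart :=
  {e | G.dist o e.snd = G.dist o e.fst + 1 ∧ G.dist o e.snd ≤ n}

theorem finite_ballArcs [∀ v : V, Fintype (G.neighborSet v)] (hc : G.Connected) (n : ℕ) :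
    (ballArcs G o n).Finite := by
  have hf := (finite_ball_s19 G o hc n).prod (finite_ball_s19 G o hc n)
  refine Set.Finite.of_finite_image (f := SimpleGraph.Dart.toProd) (hf.subset ?_)
    (SimpleGraph.Dart.toProd_injective.injOn)
  rintro _ ⟨e, he, rfl⟩
  exact he

theorem outArcs_subset_ballArcs (n : ℕ) : outArcs G o n ⊆ ballArcs G o n := by
  rintro e ⟨h1, h2⟩
  exact ⟨by omega, h2⟩

theorem card_outArcs_add_one [∀ v : V, Fintype (G.neighborSet v)] (hG : G.IsTree) (n : ℕ) :
    Nat.card (outArcs G o n) + 1 = Nat.card {v : V // G.dist o v ≤ n} := by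
  have hfin := finite_ball_s19 G o hG.connected n
  have himg : (fun e : G.Dart => e.snd) '' outArcs G o n = {v : V | G.dist o v ≤ n} \ {o} := by
    ext v
    constructor
    · rintro ⟨e, ⟨h1, h2⟩, rfl⟩
      refine ⟨h2, fun h => ?_⟩
      rw [Set.mem_singleton_iff] at h
      simp [h] at h1
    · rintro ⟨hv, hvo⟩
      obtain ⟨w, hw⟩ := hG.connected.exists_walk_length_eq_dist v o
      cases w with
      | nil => exact absurd rfl hvo
      | @cons _ u _ hadj q =>
        have hq := G.dist_le q
        rw [SimpleGraph.Walk.length_cons] at hw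
        refine ⟨⟨(u, v), hadj.symm⟩, ⟨?_, hv⟩, rfl⟩
        have := hG.dist_eq_dist_add_one_of_adj o hadj
        simp only
        rw [SimpleGraph.dist_comm (u := o), SimpleGraph.dist_comm (u := o)] at this ⊢
        omega
  have hinj : Set.InjOn (fun e : G.Dart => e.snd) (outArcs G o n) := by
    rintro e ⟨he, -⟩ f ⟨hf, -⟩ (hef : e.snd = f.snd)
    refine SimpleGraph.Dart.ext _ _ (Prod.ext ?_ hef)
    refine eq_of_adj_of_dist_eq o hG e.adj (hef ▸ f.adj) he ?_
    rw [hef]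
    exact hf
  change (outArcs G o n).ncard + 1 = {v : V | G.dist o v ≤ n}.ncard
  rw [← hinj.ncard_image, himg, Set.ncard_sdiff_singleton_add_one (by simp) hfin]

/-- In a tree, every arc or its reversal points away from the root. -/
def outArcsSumEquiv {G : SimpleGraph V} (hG : G.IsTree) (n : ℕ) :
    outArcs G o n ⊕ outArcs G o n ≃ ballArcs G o n :=
  Equiv.ofBijective
    (Sum.elim (fun e => ⟨e.1, outArcs_subset_ballArcs G o n e.2⟩)
      (fun e => ⟨e.1.symm, (outArcs_subset_ballArcs G o n e.2).symm⟩)) <| by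
    constructor
    · rintro (⟨e, he⟩ | ⟨e, he⟩) (⟨f, hf⟩ | ⟨f, hf⟩) hef <;>
        replace hef := congrArg Subtype.val hef
      · obtain rfl : e = f := hef
        rfl
      · obtain rfl : e = f.symm := hef
        have h1 : G.dist o f.fst = G.dist o f.snd + 1 := he.1
        have h2 := hf.1
        omega
      · obtain rfl : e.symm = f := hef
        have h1 : G.dist o e.fst = G.dist o e.snd + 1 := hf.1
        have h2 := he.1
        omega
      · obtain rfl : e = f := SimpleGraph.Dart.symm_involutive.injective hef
        rfl
    · rintro ⟨e, he⟩
      rcases hG.dist_eq_dist_add_one_of_adj o e.adj with h | h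
      · exact ⟨Sum.inr ⟨e.symm, h, he.1⟩, by simp⟩
      · exact ⟨Sum.inl ⟨e, h, he.2⟩, rfl⟩

theorem card_ballArcs [∀ v : V, Fintype (G.neighborSet v)] (hG : G.IsTree) (n : ℕ) :
    Nat.card (ballArcs G o n) = 2 * Nat.card (outArcs G o n) := by
  have : Finite (outArcs G o n) :=
    (finite_ballArcs G o hG.connected n).subset (outArcs_subset_ballArcs G o n)
  rw [← Nat.card_congr (outArcsSumEquiv o hG n), Nat.card_sum, two_mul]

end Graph

section Analysis

theorem liminf_add_of_tendsto_zero {u v : ℕ → ℝ} (ha : BddAbove (Set.range u))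
    (hb : BddBelow (Set.range u)) (hv : Tendsto v atTop (𝓝 0)) :
    liminf (fun n => u n + v n) atTop = liminf u atTop := by
  have key : ∀ {u v : ℕ → ℝ}, IsBoundedUnder (· ≤ ·) atTop u → IsBoundedUnder (· ≥ ·) atTop u →
      Tendsto v atTop (𝓝 0) → liminf u atTop ≤ liminf (fun n => u n + v n) atTop := by
    intro u v ha hb hv
    have := le_liminf_add (f := atTop) (u := u) (v := v) hb
      ha hv.isBoundedUnder_ge hv.isCoboundedUnder_ge
    rw [hv.liminf_eq, add_zero] at this
    exact this
  have hau := ha.isBoundedUnder_of_range (f := atTop)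
  have hbu := hb.isBoundedUnder_of_range (f := atTop)
  refine le_antisymm ?_ (key hau hbu hv)
  have := key (u := fun n => u n + v n) (v := fun n => -v n)
    (isBoundedUnder_le_add hau hv.isBoundedUnder_le)
    (isBoundedUnder_ge_add hbu hv.isBoundedUnder_ge) (by simpa using hv.neg)
  simpa using this

theorem limsup_add_of_tendsto_zero {u v : ℕ → ℝ} (ha : BddAbove (Set.range u))
    (hb : BddBelow (Set.range u)) (hv : Tendsto v atTop (𝓝 0)) :
    limsup (fun n => u n + v n) atTop = limsup u atTop := by
  have key : ∀ {u v : ℕ → ℝ}, IsBoundedUnder (· ≤ ·) atTop u → IsBoundedUnder (· ≥ ·) atTop u →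
      Tendsto v atTop (𝓝 0) → limsup (fun n => u n + v n) atTop ≤ limsup u atTop := by
    intro u v ha hb hv
    have := limsup_add_le (f := atTop) (u := u) (v := v) hb
      ha hv.isCoboundedUnder_le hv.isBoundedUnder_le
    rw [hv.limsup_eq, add_zero] at this
    exact this
  have hau := ha.isBoundedUnder_of_range (f := atTop)
  have hbu := hb.isBoundedUnder_of_range (f := atTop)
  refine le_antisymm (key hau hbu hv) ?_
  have := key (u := fun n => u n + v n) (v := fun n => -v n)
    (isBoundedUnder_le_add hau hv.isBoundedUnder_le)
    (isBoundedUnder_ge_add hbu hv.isBoundedUnder_ge) (by simpa using hv.neg)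
  simpa using this

/-- A monotone extension to `ℝ` of the map `x ↦ x / (2 * (1 + x))` on `[0, ∞)`. -/
def density (x : ℝ) : ℝ := max x 0 / (2 * (1 + max x 0))

theorem density_of_nonneg {x : ℝ} (hx : 0 ≤ x) : density x = x / (2 * (1 + x)) := by
  rw [density, max_eq_left hx]

theorem monotone_density : Monotone density := by
  intro x y hxy
  have h1 : max x 0 ≤ max y 0 := max_le_max_right 0 hxy
  have h2 : 0 ≤ max x 0 := le_max_right _ _
  unfold density
  rw [div_le_div_iff₀ (by positivity) (by positivity)]
  nlinarith

theorem continuous_density : Continuous density := by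
  unfold density
  refine Continuous.div (by fun_prop) (by fun_prop) fun x => ?_
  have : 0 ≤ max x 0 := le_max_right _ _
  positivity

section Growth

variable {B r : ℕ → ℕ} {ρ : ℕ → ℝ}

theorem ratio_eq_density (hB : ∀ n, 0 < B n) (hr : ∀ n, r n + B n + 1 = B (n + 1))
    (hρ : ∀ n, ρ n = r n / (2 * ((B (n + 1) : ℝ) - 1))) (n : ℕ) :
    ρ n = density (((B (n + 1) : ℝ) - B n) / B n + -(B n : ℝ)⁻¹) := by
  have hpos : (0 : ℝ) < B n := by exact_mod_cast hB n
  have hsum : (B (n + 1) : ℝ) = r n + B n + 1 := by exact_mod_cast (hr n).symm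
  have hx : ((B (n + 1) : ℝ) - B n) / B n + -(B n : ℝ)⁻¹ = r n / B n := by
    rw [hsum]
    field_simp
    ring
  rw [hx, density_of_nonneg (by positivity), hρ, hsum, add_sub_cancel_right]
  field_simp
  ring

theorem tendsto_neg_inv_ball (hr : ∀ n, r n + B n + 1 = B (n + 1)) :
    Tendsto (fun n => -(B n : ℝ)⁻¹) atTop (𝓝 0) := by
  have hmono : StrictMono B := strictMono_nat_of_lt_succ fun n => by
    have := hr n
    omega
  simpa using (tendsto_inv_atTop_zero.comp
    (tendsto_natCast_atTop_atTop (R := ℝ) |>.comp hmono.tendsto_atTop)).neg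

theorem tendsto_ratio (hB : ∀ n, 0 < B n) (hr : ∀ n, r n + B n + 1 = B (n + 1))
    (hρ : ∀ n, ρ n = r n / (2 * ((B (n + 1) : ℝ) - 1))) {h : ℝ} (hh : 0 < h)
    (hlim : Tendsto (fun n => ((B (n + 1) : ℝ) - B n) / B n) atTop (𝓝 h)) :
    Tendsto ρ atTop (𝓝 (h / (2 * (1 + h)))) := by
  rw [← density_of_nonneg hh.le, funext (ratio_eq_density hB hr hρ)]
  refine (continuous_density.tendsto h).comp ?_
  simpa using hlim.add (tendsto_neg_inv_ball hr)

theorem bddBelow_growth (hr : ∀ n, r n + B n + 1 = B (n + 1)) :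
    BddBelow (Set.range fun n => ((B (n + 1) : ℝ) - B n) / B n) := by
  refine ⟨0, ?_⟩
  rintro _ ⟨n, rfl⟩
  have : (B n : ℝ) ≤ B (n + 1) := by
    have := hr n
    exact_mod_cast (by omega : B n ≤ B (n + 1))
  exact div_nonneg (by linarith) (by positivity)

theorem liminf_limsup_ratio (hB : ∀ n, 0 < B n) (hr : ∀ n, r n + B n + 1 = B (n + 1))
    (hρ : ∀ n, ρ n = r n / (2 * ((B (n + 1) : ℝ) - 1))) {a b : ℝ}
    (ha : liminf (fun n => ((B (n + 1) : ℝ) - B n) / B n) atTop = a)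
    (hb : limsup (fun n => ((B (n + 1) : ℝ) - B n) / B n) atTop = b) (ha0 : 0 ≤ a) (hb0 : 0 ≤ b)
    (hbdd : BddAbove (Set.range fun n => ((B (n + 1) : ℝ) - B n) / B n)) :
    liminf ρ atTop = a / (2 * (1 + a)) ∧ limsup ρ atTop = b / (2 * (1 + b)) := by
  have hlow := bddBelow_growth hr
  have hv := tendsto_neg_inv_ball hr
  have habove := isBoundedUnder_le_add (hbdd.isBoundedUnder_of_range (f := atTop))
    hv.isBoundedUnder_le
  have hbelow := isBoundedUnder_ge_add (hlow.isBoundedUnder_of_range (f := atTop))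
    hv.isBoundedUnder_ge
  rw [← density_of_nonneg ha0, ← density_of_nonneg hb0, ← ha, ← hb,
    funext (ratio_eq_density hB hr hρ), ← liminf_add_of_tendsto_zero hbdd hlow hv,
    ← limsup_add_of_tendsto_zero hbdd hlow hv]
  exact ⟨(monotone_density.map_liminf_of_continuousAt _ continuous_density.continuousAt
      habove.isCoboundedUnder_ge hbelow).symm,
    (monotone_density.map_limsup_of_continuousAt _ continuous_density.continuousAt
      habove hbelow.isCoboundedUnder_le).symm⟩

end Growth

end Analysis

section Dimension

variable {G}

/-- A function on the arcs with finite support, as an element of `ℓ²(A)`. -/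
def ofFiniteSupport (φ : G.Dart → ℂ) (hφ : {e | φ e ≠ 0}.Finite) : lA G :=
  ⟨φ, (memℓp_zero hφ).of_exponent_ge (by simp)⟩

@[simp]
theorem ofFiniteSupport_apply (φ : G.Dart → ℂ) (hφ : {e | φ e ≠ 0}.Finite) (e : G.Dart) :
    ofFiniteSupport φ hφ e = φ e :=
  rfl

/-- Restriction of functions in `ℓ²(A)` to a set of arcs. -/
def restrictArcs (s : Set G.Dart) : lA G →ₗ[ℂ] (s → ℂ) where
  toFun ψ e := ψ e.1
  map_add' _ _ := rfl
  map_smul' _ _ := rfl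

theorem finrank_suppSubmodule {s : Set G.Dart} (hs : s.Finite) :
    Module.finrank ℂ (suppSubmodule G s) = Nat.card s := by
  have : Fintype s := hs.fintype
  have hbij : Function.Bijective ((restrictArcs s).domRestrict (suppSubmodule G s)) := by
    constructor
    · rintro ⟨ψ, hψ⟩ ⟨χ, hχ⟩ h
      refine Subtype.ext (lp.ext (funext fun e => ?_))
      by_cases he : e ∈ s
      · exact congrFun h ⟨e, he⟩
      · exact (hψ e he).trans (hχ e he).symm
    · intro φ
      refine ⟨⟨ofFiniteSupport (fun e => if he : e ∈ s then φ ⟨e, he⟩ else 0)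
        (hs.subset fun e he => ?_), fun e he => ?_⟩, funext fun e => ?_⟩
      · by_contra h
        exact he (dif_neg h)
      · exact dif_neg he
      · exact dif_pos e.2
  rw [(LinearEquiv.ofBijective _ hbij).finrank_eq, Module.finrank_fintype_fun_eq_card,
    Nat.card_eq_fintype_card]

theorem eq_of_restrictArcs_outArcs_eq {o : V} {n : ℕ} (hG : G.IsTree) {s : ℂ} {ψ χ : lA G}
    (hψ : ψ ∈ suppSubmodule G (ballArcs G o n)) (hχ : χ ∈ suppSubmodule G (ballArcs G o n))
    (hψs : ∀ e : G.Dart, ψ e.symm = -s * ψ e) (hχs : ∀ e : G.Dart, χ e.symm = -s * χ e)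
    (h : restrictArcs (outArcs G o n) ψ = restrictArcs (outArcs G o n) χ) : ψ = χ := by
  refine lp.ext (funext fun e => ?_)
  by_cases he : e ∈ ballArcs G o n
  · rcases hG.dist_eq_dist_add_one_of_adj o e.adj with hd | hd
    · have h1 : ψ e.symm = χ e.symm := congrFun h ⟨e.symm, hd, he.1⟩
      rw [← e.symm_symm, hψs e.symm, hχs e.symm, h1]
    · exact congrFun h ⟨e, hd, he.2⟩
  · exact (hψ e he).trans (hχ e he).symm

theorem inner_single_one_left {ι : Type} [DecidableEq ι] (i : ι) (f : lp (fun _ : ι => ℂ) 2) :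
    inner ℂ (lp.single 2 i (1 : ℂ)) f = f i := by
  rw [lp.inner_single_left]
  simp

variable [∀ v : V, Fintype (G.neighborSet v)]

theorem finite_dart_snd (u : V) : Finite {e : G.Dart // e.snd = u} := by
  refine Finite.of_injective (β := G.neighborSet u) (fun e => ⟨e.1.fst, by
    have := e.1.adj
    rw [e.2] at this
    exact this.symm⟩) ?_
  rintro ⟨e, rfl⟩ ⟨f, hf⟩ h
  exact Subtype.ext (SimpleGraph.Dart.ext _ _ (Prod.ext (congrArg Subtype.val h) hf.symm))

theorem boundary_apply {dT : lA G →L[ℂ] lV V} (hdT : IsBoundaryT G dT) (ψ : lA G) (u : V) :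
    dT ψ u = (∑' e : {e : G.Dart // e.snd = u}, ψ e.1) / (Real.sqrt (G.degree u) : ℂ) := by
  rw [hdT, tsum_div_const]

theorem boundary_single {dT : lA G →L[ℂ] lV V} (hdT : IsBoundaryT G dT) (e : G.Dart) :
    dT (lp.single 2 e 1) = lp.single 2 e.snd (1 / (Real.sqrt (G.degree e.snd) : ℂ)) := by
  refine lp.ext (funext fun u => ?_)
  rw [boundary_apply hdT, lp.single_apply]
  by_cases hu : u = e.snd
  · subst hu
    rw [tsum_eq_single ⟨e, rfl⟩]
    · simp
    · rintro ⟨f, hf⟩ hne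
      refine lp.single_apply_ne 2 _ _ fun h => hne (Subtype.ext h)
  · rw [Pi.single_eq_of_ne hu]
    have : ∀ f : {f : G.Dart // f.snd = u}, (lp.single 2 e (1 : ℂ) : lA G) f.1 = 0 := by
      rintro ⟨f, hf⟩
      refine lp.single_apply_ne 2 _ _ fun h => hu (hf.symm.trans ?_)
      exact congrArg (fun e : G.Dart => e.snd) h
    rw [tsum_congr this, tsum_zero, zero_div]

section CutOff

variable {o : V} {n : ℕ} {dT : lA G →L[ℂ] lV V} {S : lA G →L[ℂ] lA G} {P : lV V →L[ℂ] lV V}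

theorem adjoint_cutOff_apply (hdT : IsBoundaryT G dT)
    (hP : ∀ (f : lV V) (v : V),
      (G.dist o v ≤ n → P f v = f v) ∧ (¬ G.dist o v ≤ n → P f v = 0))
    (g : lV V) (e : G.Dart) :
    adjoint (P ∘L dT) g e =
      if G.dist o e.snd ≤ n then g e.snd / (Real.sqrt (G.degree e.snd) : ℂ) else 0 := by
  have hsingle : (P ∘L dT) (lp.single 2 e 1) =
      if G.dist o e.snd ≤ n then lp.single 2 e.snd (1 / (Real.sqrt (G.degree e.snd) : ℂ))
      else 0 := by
    rw [ContinuousLinearMap.comp_apply, boundary_single hdT]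
    refine lp.ext (funext fun v => ?_)
    by_cases hv : G.dist o v ≤ n
    · rw [(hP _ v).1 hv]
      split_ifs with he
      · rfl
      · refine lp.single_apply_ne 2 e.snd _ ?_
        rintro rfl
        exact he hv
    · rw [(hP _ v).2 hv]
      split_ifs with he
      · refine (lp.single_apply_ne (E := fun _ : V => ℂ) 2 e.snd _ ?_).symm
        rintro rfl
        exact hv he
      · rfl
  rw [← inner_single_one_left e, adjoint_inner_right]
  refine (congrArg (fun x => inner ℂ x g) hsingle).trans ?_
  dsimp only
  split_ifs
  · rw [lp.inner_single_left]
    simp [div_eq_mul_inv]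
  · simp

theorem grover_cutOff_apply (hdT : IsBoundaryT G dT)
    (hS : IsShift G S)
    (hP : ∀ (f : lV V) (v : V),
      (G.dist o v ≤ n → P f v = f v) ∧ (¬ G.dist o v ≤ n → P f v = 0))
    (ψ : lA G) (e : G.Dart) :
    grover G S (P ∘L dT) ψ e =
      (if G.dist o e.fst ≤ n then
        2 * (∑' f : {f : G.Dart // f.snd = e.fst}, ψ f.1) / (G.degree e.fst : ℂ) else 0) -
        ψ e.symm := by
  have h1 : grover G S (P ∘L dT) ψ e =
      2 * adjoint (P ∘L dT) ((P ∘L dT) ψ) e.symm - ψ e.symm := hS _ e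
  rw [h1, adjoint_cutOff_apply hdT hP]
  change 2 * (if G.dist o e.fst ≤ n then _ else _) - _ = _
  congr 1
  split_ifs with he
  · change 2 * (P (dT ψ) e.fst / ((Real.sqrt (G.degree e.fst) : ℝ) : ℂ)) = _
    rw [(hP _ _).1 he, boundary_apply hdT, div_div, ← Complex.ofReal_mul,
      Real.mul_self_sqrt (Nat.cast_nonneg _), mul_div_assoc, Complex.ofReal_natCast]
  · simp

theorem mem_ker_grover_cutOff_iff [Infinite V] (hc : G.Connected)
    (hdeg : ∀ v : V, 2 ≤ G.degree v) (hdT : IsBoundaryT G dT) (hS : IsShift G S)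
    (hP : ∀ (f : lV V) (v : V),
      (G.dist o v ≤ n → P f v = f v) ∧ (¬ G.dist o v ≤ n → P f v = 0))
    {s : ℂ} (hs : s * s = 1) (ψ : lA G) :
    ψ ∈ LinearMap.ker ((grover G S (P ∘L dT)).toLinearMap - s • 1) ↔
      (∀ e : G.Dart, ψ e.symm = -s * ψ e) ∧
      ∀ u, G.dist o u ≤ n → ∑' f : {f : G.Dart // f.snd = u}, ψ f.1 = 0 := by
  set F : V → ℂ := fun u => if G.dist o u ≤ n then
    2 * (∑' f : {f : G.Dart // f.snd = u}, ψ f.1) / (G.degree u : ℂ) else 0 with hF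
  have hmem : ψ ∈ LinearMap.ker ((grover G S (P ∘L dT)).toLinearMap - s • 1) ↔
      ∀ e : G.Dart, F e.fst = ψ e.symm + s * ψ e := by
    have h1 : ψ ∈ LinearMap.ker ((grover G S (P ∘L dT)).toLinearMap - s • 1) ↔
        grover G S (P ∘L dT) ψ = s • ψ := by
      rw [LinearMap.mem_ker, LinearMap.sub_apply, sub_eq_zero]
      rfl
    rw [h1]
    constructor
    · intro h e
      have h2 := grover_cutOff_apply hdT hS hP ψ e
      rw [h] at h2
      have h3 : s * ψ e = F e.fst - ψ e.symm := h2
      rw [h3]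
      ring
    · intro h
      refine lp.ext (funext fun e => ?_)
      rw [grover_cutOff_apply hdT hS hP ψ e]
      change F e.fst - ψ e.symm = s * ψ e
      rw [h e]
      ring
  have hF0 : (∀ u, F u = 0) ↔
      ∀ u, G.dist o u ≤ n → ∑' f : {f : G.Dart // f.snd = u}, ψ f.1 = 0 := by
    refine forall_congr' fun u => ?_
    have hd : (G.degree u : ℂ) ≠ 0 := by
      have := hdeg u
      exact_mod_cast (by omega : G.degree u ≠ 0)
    by_cases hu : G.dist o u ≤ n <;> simp [hF, hu, hd]
  rw [hmem, ← hF0]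
  constructor
  · intro h
    have hzero : ∀ u, F u = 0 := by
      obtain ⟨w, hw⟩ := exists_lt_dist G o hc n
      refine forall_of_adj hc (fun u v huv hu => ?_) (w := w) (by simp [hF, hw.not_ge])
      have h1 := h ⟨(u, v), huv⟩
      have h2 := h (SimpleGraph.Dart.symm ⟨(u, v), huv⟩)
      rw [SimpleGraph.Dart.symm_symm] at h2
      change F u = _ at h1
      change F v = _ at h2
      rw [hu] at h1
      rw [h2]
      linear_combination (-s) * h1 - ψ ⟨(u, v), huv⟩ * hs
    refine ⟨fun e => ?_, hzero⟩
    have := h e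
    rw [hzero] at this
    linear_combination -this
  · rintro ⟨h1, h2⟩ e
    rw [h1, h2]
    ring

/-- The matrix, from functions on the outgoing arcs of the ball of radius `n + 1` to functions on
the ball of radius `n`, that expresses `Σ_{t(f) = u} ψ(f) = 0` for the functions with
`ψ(ē) = -s ψ(e)`. -/
def divergence (G : SimpleGraph V) (o : V) (n : ℕ) (s : ℂ) :
    Matrix {v : V // G.dist o v ≤ n} (outArcs G o (n + 1)) ℂ :=
  fun u e => (if e.1.snd = u.1 then 1 else 0) - s * (if e.1.fst = u.1 then 1 else 0)

theorem finrank_ker_divergence [Infinite V] (hG : G.IsTree) {s : ℂ} (hs : s * s = 1)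
    [Fintype {v : V // G.dist o v ≤ n}] [Fintype (outArcs G o (n + 1))] :
    Module.finrank ℂ (LinearMap.ker (divergence G o n s).mulVecLin) +
      Nat.card {v : V // G.dist o v ≤ n} + 1 = Nat.card {v : V // G.dist o v ≤ n + 1} := by
  have hinj : Function.Injective (divergence G o n s).transpose.mulVecLin := by
    rw [← LinearMap.ker_eq_bot, LinearMap.ker_eq_bot']
    intro h hh
    set H : V → ℂ := fun v => if hv : G.dist o v ≤ n then h ⟨v, hv⟩ else 0 with hH
    have hsum : ∀ w, ∑ x : {v : V // G.dist o v ≤ n}, (if w = x.1 then 1 else 0) * h x = H w := by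
      intro w
      by_cases hw : G.dist o w ≤ n
      · rw [Finset.sum_eq_single ⟨w, hw⟩]
        · simp [hH, hw]
        · intro b _ hb
          rw [if_neg fun h => hb (Subtype.ext h.symm), zero_mul]
        · simp
      · simp only [hH, dif_neg hw]
        refine Finset.sum_eq_zero fun x _ => ?_
        rw [if_neg, zero_mul]
        rintro rfl
        exact hw x.2
    have hout : ∀ e : G.Dart, G.dist o e.snd = G.dist o e.fst + 1 → H e.snd = s * H e.fst := by
      intro e he
      by_cases hn : G.dist o e.snd ≤ n + 1
      · have h1 := congrFun hh ⟨e, he, hn⟩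
        simp only [Matrix.mulVecLin_apply, Matrix.mulVec, dotProduct, Matrix.transpose_apply,
          divergence, Pi.zero_apply, sub_mul, Finset.sum_sub_distrib, mul_assoc,
          ← Finset.mul_sum] at h1
        rw [hsum, hsum] at h1
        exact sub_eq_zero.1 h1
      · have h1 : ¬ G.dist o e.snd ≤ n := by omega
        have h2 : ¬ G.dist o e.fst ≤ n := by omega
        simp [hH, h1, h2]
    have hzero : ∀ v, H v = 0 := by
      obtain ⟨w, hw⟩ := exists_lt_dist G o hG.connected n
      refine forall_of_adj hG.connected (fun u v huv hu => ?_) (w := w) (by simp [hH, hw.not_ge])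
      rcases hG.dist_eq_dist_add_one_of_adj o huv with hd | hd
      · have h1 : H u = s * H v := hout ⟨(v, u), huv.symm⟩ hd
        linear_combination (-H v) * hs - s * h1 + s * hu
      · have h1 : H v = s * H u := hout ⟨(u, v), huv⟩ hd
        rw [h1, hu, mul_zero]
    funext v
    exact (dif_pos v.2).symm.trans (hzero v.1)
  have hrank : (divergence G o n s).rank = Nat.card {v : V // G.dist o v ≤ n} := by
    rw [← Matrix.rank_transpose, Matrix.rank, LinearMap.finrank_range_of_inj hinj,
      Module.finrank_fintype_fun_eq_card, Nat.card_eq_fintype_card]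
  have h1 := (divergence G o n s).mulVecLin.finrank_range_add_finrank_ker
  rw [← Matrix.rank, hrank, Module.finrank_fintype_fun_eq_card, ← Nat.card_eq_fintype_card] at h1
  have h2 := card_outArcs_add_one G o hG (n + 1)
  omega

theorem divergence_mulVec (hG : G.IsTree) {s : ℂ} [Fintype (outArcs G o (n + 1))] {ψ : lA G}
    (hsupp : ψ ∈ suppSubmodule G (ballArcs G o (n + 1)))
    (hψ : ∀ e : G.Dart, ψ e.symm = -s * ψ e) (u : {v : V // G.dist o v ≤ n}) :
    (divergence G o n s).mulVec (restrictArcs (outArcs G o (n + 1)) ψ) u =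
      ∑' f : {f : G.Dart // f.snd = u.1}, ψ f.1 := by
  have : Fintype (ballArcs G o (n + 1)) := (finite_ballArcs G o hG.connected (n + 1)).fintype
  have h1 : ∑' f : {f : G.Dart // f.snd = u.1}, ψ f.1 =
      ∑ f : ballArcs G o (n + 1), if f.1.snd = u.1 then ψ f.1 else 0 := by
    have h2 : ∑' f : {f : G.Dart // f.snd = u.1}, ψ f.1 =
        ∑' f, Set.indicator {f : G.Dart | f.snd = u.1} ψ f :=
      tsum_subtype {f : G.Dart | f.snd = u.1} ψ
    rw [h2, ← tsum_fintype (L := .unconditional _),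
      tsum_subtype (ballArcs G o (n + 1)) fun f => if f.snd = u.1 then ψ f else 0]
    refine tsum_congr fun f => ?_
    by_cases hf : f ∈ ballArcs G o (n + 1)
    · rw [Set.indicator_of_mem hf]
      rfl
    · rw [Set.indicator_of_notMem hf]
      exact Set.indicator_apply_eq_zero.2 fun _ => hsupp f hf
  rw [h1, ← (outArcsSumEquiv o hG (n + 1)).sum_comp, Fintype.sum_sum_type,
    ← Finset.sum_add_distrib]
  refine Finset.sum_congr rfl fun e _ => ?_
  change (((if e.1.snd = u.1 then 1 else 0) - s * (if e.1.fst = u.1 then 1 else 0)) * ψ e.1 : ℂ) =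
    (if e.1.snd = u.1 then ψ e.1 else 0) + (if e.1.fst = u.1 then ψ e.1.symm else 0)
  rw [hψ]
  split_ifs <;> ring

theorem exists_restrictArcs_outArcs_eq (hG : G.IsTree) {s : ℂ} (hs : s * s = 1)
    (φ : outArcs G o n → ℂ) :
    ∃ ψ ∈ suppSubmodule G (ballArcs G o n), (∀ e : G.Dart, ψ e.symm = -s * ψ e) ∧
      restrictArcs (outArcs G o n) ψ = φ := by
  set f : G.Dart → ℂ := fun e => if he : e ∈ outArcs G o n then φ ⟨e, he⟩ else 0 with hf
  have hdisj : ∀ e ∈ outArcs G o n, e.symm ∉ outArcs G o n := by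
    rintro e ⟨h1, -⟩ ⟨h2, -⟩
    change G.dist o e.fst = G.dist o e.snd + 1 at h2
    omega
  have hsupp : ∀ e ∉ ballArcs G o n, f e - s * f e.symm = 0 := by
    intro e he
    have h1 : e ∉ outArcs G o n := fun h => he (outArcs_subset_ballArcs G o n h)
    have h2 : e.symm ∉ outArcs G o n := fun h => he (outArcs_subset_ballArcs G o n h).symm
    simp only [hf, dif_neg h1, dif_neg h2, mul_zero, sub_zero]
  refine ⟨ofFiniteSupport (fun e => f e - s * f e.symm)
    ((finite_ballArcs G o hG.connected n).subset fun e he => ?_), hsupp, fun e => ?_,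
    funext fun e => ?_⟩
  · by_contra h
    exact he (hsupp e h)
  · simp only [ofFiniteSupport_apply, SimpleGraph.Dart.symm_symm]
    linear_combination -f e.symm * hs
  · change f e.1 - s * f e.1.symm = φ e
    simp only [hf, dif_pos e.2, dif_neg (hdisj e.1 e.2), mul_zero, sub_zero]

theorem finrank_ker_grover_cutOff [Infinite V] (hG : G.IsTree)
    (hdeg : ∀ v : V, 2 ≤ G.degree v) (hdT : IsBoundaryT G dT) (hS : IsShift G S)
    (hP : ∀ (f : lV V) (v : V),
      (G.dist o v ≤ n → P f v = f v) ∧ (¬ G.dist o v ≤ n → P f v = 0))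
    {s : ℂ} (hs : s * s = 1) :
    Module.finrank ℂ ↥(LinearMap.ker ((grover G S (P ∘L dT)).toLinearMap - s • 1) ⊓
        suppSubmodule G (ballArcs G o (n + 1))) +
      Nat.card {v : V // G.dist o v ≤ n} + 1 = Nat.card {v : V // G.dist o v ≤ n + 1} := by
  have : Fintype {v : V // G.dist o v ≤ n} := (finite_ball_s19 G o hG.connected n).fintype
  have : Fintype (outArcs G o (n + 1)) :=
    ((finite_ballArcs G o hG.connected (n + 1)).subset
      (outArcs_subset_ballArcs G o (n + 1))).fintype
  rw [← finrank_ker_divergence hG hs]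
  congr 2
  set K := LinearMap.ker ((grover G S (P ∘L dT)).toLinearMap - s • 1) ⊓
    suppSubmodule G (ballArcs G o (n + 1)) with hK
  have hmem := mem_ker_grover_cutOff_iff hG.connected hdeg hdT hS hP hs
  set R := (restrictArcs (outArcs G o (n + 1))).domRestrict K with hR
  have hinj : Function.Injective R := by
    rintro ⟨ψ, hψ⟩ ⟨χ, hχ⟩ h
    exact Subtype.ext (eq_of_restrictArcs_outArcs_eq hG hψ.2 hχ.2 ((hmem ψ).1 hψ.1).1
      ((hmem χ).1 hχ.1).1 h)
  have hrange : LinearMap.range R = LinearMap.ker (divergence G o n s).mulVecLin := by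
    ext φ
    rw [LinearMap.mem_ker, Matrix.mulVecLin_apply]
    constructor
    · rintro ⟨⟨ψ, hψ⟩, rfl⟩
      obtain ⟨h1, h2⟩ := (hmem ψ).1 hψ.1
      exact funext fun u => (divergence_mulVec hG hψ.2 h1 u).trans (h2 u.1 u.2)
    · intro hφ
      obtain ⟨ψ, hψ, h1, rfl⟩ := exists_restrictArcs_outArcs_eq hG hs φ
      refine ⟨⟨ψ, (hmem ψ).2 ⟨h1, fun u hu => ?_⟩, hψ⟩, rfl⟩
      exact (divergence_mulVec hG hψ h1 ⟨u, hu⟩).symm.trans (congrFun hφ _)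
  rw [← LinearMap.finrank_range_of_inj hinj, hrange]

end CutOff

end Dimension

/-- densities of the birth part of the cut-off walks. With
`B_n = |V_n|`, `∂B_n = B_{n+1} − B_n`, and
`ρ_n^(±) = dim(ker(U^(n) ∓ 1) ∩ 𝒜_{n+1})/dim 𝒜_{n+1}`, if
`h₋ = liminf ∂B_n/B_n > 0` and `h₊ = limsup ∂B_n/B_n < ∞`, then
`liminf ρ_n^(±) = h₋/(2(1+h₋)) > 0` and `limsup ρ_n^(±) = h₊/(2(1+h₊)) ≤ 1/2`;
if `∂B_n/B_n → h (0 < h < ∞)` then `ρ_n^(±) → h/(2(1+h))`. -/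
theorem statement19 {V : Type} (G : SimpleGraph V) [∀ v : V, Fintype (G.neighborSet v)]
    (hG : G.IsTree) [Infinite V] (o : V)
    (hdeg : ∀ v : V, 2 ≤ G.degree v)
    (dT : lA G →L[ℂ] lV V) (S : lA G →L[ℂ] lA G)
    (hdT : IsBoundaryT G dT) (hS : IsShift G S)
    -- `P n` is the orthogonal projection of ℓ²(V) onto functions supported in V_n
    (P : ℕ → (lV V →L[ℂ] lV V))
    (hP : ∀ (n : ℕ) (f : lV V) (v : V),
      (G.dist o v ≤ n → P n f v = f v) ∧ (¬ G.dist o v ≤ n → P n f v = 0)) :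
    letI B : ℕ → ℝ := fun n => (Nat.card {v : V // G.dist o v ≤ n} : ℝ)
    letI dB : ℕ → ℝ := fun n => B (n + 1) - B n
    letI 𝒜 : ℕ → Submodule ℂ (lA G) := fun n =>
      suppSubmodule G {e : G.Dart | G.dist o e.fst ≤ n ∧ G.dist o e.snd ≤ n}
    letI ρ : ℂ → ℕ → ℝ := fun s n =>
      (Module.finrank ℂ
          ↥(LinearMap.ker ((grover G S (P n ∘L dT)).toLinearMap - s • 1) ⊓ 𝒜 (n + 1)) : ℝ) /
        (Module.finrank ℂ ↥(𝒜 (n + 1)) : ℝ)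
    letI hm : ℝ := Filter.liminf (fun n => dB n / B n) atTop
    letI hp : ℝ := Filter.limsup (fun n => dB n / B n) atTop
    0 < hm →
    BddAbove (Set.range fun n => dB n / B n) →
    (Filter.liminf (ρ 1) atTop = hm / (2 * (1 + hm)) ∧
     Filter.liminf (ρ (-1)) atTop = hm / (2 * (1 + hm)) ∧
     0 < hm / (2 * (1 + hm)) ∧
     Filter.limsup (ρ 1) atTop = hp / (2 * (1 + hp)) ∧
     Filter.limsup (ρ (-1)) atTop = hp / (2 * (1 + hp)) ∧
     hp / (2 * (1 + hp)) ≤ 1 / 2) ∧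
    (∀ h : ℝ, 0 < h → Tendsto (fun n => dB n / B n) atTop (𝓝 h) →
      Tendsto (ρ 1) atTop (𝓝 (h / (2 * (1 + h)))) ∧
      Tendsto (ρ (-1)) atTop (𝓝 (h / (2 * (1 + h))))) := by
  have hc := hG.connected
  have hpos : ∀ n, 0 < Nat.card {v : V // G.dist o v ≤ n} := fun n => by
    have : Finite {v : V // G.dist o v ≤ n} := finite_ball_s19 G o hc n
    have : Nonempty {v : V // G.dist o v ≤ n} := ⟨⟨o, by simp⟩⟩
    exact Nat.card_pos
  have hr : ∀ s : ℂ, s * s = 1 → ∀ n, _ := fun s hs n =>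
    finrank_ker_grover_cutOff (n := n) hG hdeg hdT hS (hP n) hs
  have hρ : ∀ s : ℂ, ∀ n, (Module.finrank ℂ
          ↥(LinearMap.ker ((grover G S (P n ∘L dT)).toLinearMap - s • 1) ⊓
            suppSubmodule G (ballArcs G o (n + 1))) : ℝ) /
        (Module.finrank ℂ ↥(suppSubmodule G (ballArcs G o (n + 1))) : ℝ) =
      (Module.finrank ℂ
          ↥(LinearMap.ker ((grover G S (P n ∘L dT)).toLinearMap - s • 1) ⊓
            suppSubmodule G (ballArcs G o (n + 1))) : ℝ) /
        (2 * ((Nat.card {v : V // G.dist o v ≤ n + 1} : ℝ) - 1)) := fun s n => by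
    rw [finrank_suppSubmodule (finite_ballArcs G o hc (n + 1)), card_ballArcs G o hG,
      ← card_outArcs_add_one G o hG (n + 1)]
    push_cast
    rw [add_sub_cancel_right]
  have h1 : (1 : ℂ) * 1 = 1 := one_mul 1
  have h2 : (-1 : ℂ) * -1 = 1 := by norm_num
  intro hm0 hbdd
  have hlow := bddBelow_growth (hr 1 h1)
  have hle := liminf_le_limsup (hbdd.isBoundedUnder_of_range (f := atTop))
    (hlow.isBoundedUnder_of_range (f := atTop))
  have hp0 := hm0.trans_le hle
  obtain ⟨hinf, hsup⟩ :=
    liminf_limsup_ratio hpos (hr 1 h1) (hρ 1) rfl rfl hm0.le hp0.le hbdd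
  obtain ⟨hinf', hsup'⟩ :=
    liminf_limsup_ratio hpos (hr (-1) h2) (hρ (-1)) rfl rfl hm0.le hp0.le hbdd
  refine ⟨⟨hinf, hinf', by positivity, hsup, hsup', ?_⟩, fun h hh hlim =>
    ⟨tendsto_ratio hpos (hr 1 h1) (hρ 1) hh hlim,
      tendsto_ratio hpos (hr (-1) h2) (hρ (-1)) hh hlim⟩⟩
  rw [div_le_div_iff₀ (by positivity) two_pos]
  linarith

end GroverStmt
end
end
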